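/- arXiv:2401.08883 — 3 statements merged into one kernel-verified Lean document; each statement's English description precedes it below -/
import Mathlib

section
/- If X is a Hausdorff topological space and α, β : [0,1] → X are path-homotopic paths (homotopic relative to endpoints), then there exists a path γ : [0,1] → X such that γ ≥ᵣ α and γ ≥ᵣ β, i.e. both α and β are geodesic ℝ-tree reductions of the single path γ. -/
open Set Filter Topology

noncomputable section

/-- An ℝ-tree: a nonempty geodesic, uniquely arcwise connected, locally arcwise connected
metric space. -/
structure IsRTree (T : Type) [MetricSpace T] : Prop where
  nonempty : Nonempty T
  geodesic : ∀ x y : T, ∃ γ : ℝ → T, γ 0 = x ∧ γ (dist x y) = y ∧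
    ∀ s ∈ Set.Icc (0:ℝ) (dist x y), ∀ t ∈ Set.Icc (0:ℝ) (dist x y),
      dist (γ s) (γ t) = |s - t|
  uniquelyArcwise : ∀ p q : unitInterval → T, Continuous p → Continuous q →
    Function.Injective p → Function.Injective q → p 0 = q 0 → p 1 = q 1 →
    Set.range p = Set.range q
  locallyArcwise : LocPathConnectedSpace T

/-- `β` is a geodesic ℝ-tree reduction of `α`, i.e. `α ≥ᵣ β`. -/
def GeodesicReduction {X : Type*} [TopologicalSpace X] (α β : unitInterval → X) : Prop :=
  ∃ (T : Type) (_ : MetricSpace T), IsRTree T ∧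
    ∃ (f : T → X) (p r : unitInterval → T),
      Continuous f ∧ Continuous p ∧ Continuous r ∧ Function.Injective r ∧
      r 0 = p 0 ∧ r 1 = p 1 ∧ f ∘ p = α ∧ f ∘ r = β

/-- The concatenation of `α` with the reverse of `β`: `α` on `[0,1/2]`, reverse of `β`
on `[1/2,1]`. -/
def ConcatReverse {X : Type*} (α β : unitInterval → X) : unitInterval → X :=
  fun t => if (t : ℝ) ≤ 1 / 2
    then α (Set.projIcc (0:ℝ) 1 zero_le_one (2 * (t : ℝ)))
    else β (Set.projIcc (0:ℝ) 1 zero_le_one (2 - 2 * (t : ℝ)))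

/-- The standard concatenation `α·β`: `α` on `[0,1/2]`, `β` on `[1/2,1]`. -/
def PathConcat {X : Type*} (α β : unitInterval → X) : unitInterval → X :=
  fun t => if (t : ℝ) ≤ 1 / 2
    then α (Set.projIcc (0:ℝ) 1 zero_le_one (2 * (t : ℝ)))
    else β (Set.projIcc (0:ℝ) 1 zero_le_one (2 * (t : ℝ) - 1))

/-- `α ≃ᵣ β`: the loop `α·(reverse β)` factors through an ℝ-tree. -/
def RTreeHomotopic {X : Type*} [TopologicalSpace X] (α β : unitInterval → X) : Prop :=
  α 0 = β 0 ∧ α 1 = β 1 ∧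
  ∃ (T : Type) (_ : MetricSpace T), IsRTree T ∧
    ∃ (f : T → X) (ℓ : unitInterval → T),
      Continuous f ∧ Continuous ℓ ∧ ℓ 0 = ℓ 1 ∧ f ∘ ℓ = ConcatReverse α β

/-- `α ≡ β`: equality up to an increasing self-homeomorphism of `[0,1]`. -/
def PathEquiv {X : Type*} (α β : unitInterval → X) : Prop :=
  ∃ h : unitInterval ≃ₜ unitInterval, StrictMono (⇑h) ∧ α = β ∘ ⇑h

/-- Fréchet equivalence of paths. -/
def FrechetEquiv {X : Type*} (α β : unitInterval → X) : Prop :=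
  ∃ f g : unitInterval → unitInterval,
    Continuous f ∧ Continuous g ∧ Monotone f ∧ Monotone g ∧
    Function.Surjective f ∧ Function.Surjective g ∧ α ∘ f = β ∘ g

/-- `p` lifts all paths uniquely rel. starting point. -/
def LiftsPathsUniquely {E X : Type*} [TopologicalSpace E] [TopologicalSpace X]
    (p : E → X) : Prop :=
  ∀ α : unitInterval → X, Continuous α → ∀ e : E, p e = α 0 →
    ∃! αl : unitInterval → E, Continuous αl ∧ αl 0 = e ∧ p ∘ αl = α

/-- An open `U ⊆ (0,1)` is a Cantor complement if `[0,1] \ U` is homeomorphic to the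
Cantor set. -/
def IsCantorComplement (U : Set ℝ) : Prop :=
  IsOpen U ∧ U ⊆ Set.Ioo 0 1 ∧ Nonempty (↥(Set.Icc (0:ℝ) 1 \ U) ≃ₜ (ℕ → Bool))

/-- `𝒪(α)`: the set of points of `[0,1]` (as reals) at which `α` is locally constant. -/
def Oset {X : Type*} [TopologicalSpace X] (α : unitInterval → X) : Set ℝ :=
  {x | ∃ hx : x ∈ unitInterval,
    ∃ U ∈ nhds (⟨x, hx⟩ : unitInterval), ∀ s ∈ U, α s = α ⟨x, hx⟩}

/-- A Cantor path: a non-constant path whose locally-constant set is a Cantor complement. -/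
def IsCantorPath {X : Type*} [TopologicalSpace X] (α : unitInterval → X) : Prop :=
  Continuous α ∧ (∃ s t, α s ≠ α t) ∧ IsCantorComplement (Oset α)

/-- Two Cantor paths are staggered if their locally-constant sets cover `(0,1)`. -/
def StaggeredPaths {X : Type*} [TopologicalSpace X] (α β : unitInterval → X) : Prop :=
  Oset α ∪ Oset β = Set.Ioo 0 1

/-- The restriction of `β` to `[a,b]`, linearly reparameterized on `[0,1]`. -/
def restrictIcc {X : Type*} (β : unitInterval → X) (a b : ℝ) : unitInterval → X :=
  fun t => β (Set.projIcc (0:ℝ) 1 zero_le_one (a + (b - a) * (t : ℝ)))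

/-- A Cantor-inverse-pair loop (CIP-loop). -/
def IsCIPLoop {X : Type*} [TopologicalSpace X] (ℓ : unitInterval → X) : Prop :=
  ∃ (α : unitInterval → X) (h : unitInterval ≃ₜ unitInterval), StrictMono (⇑h) ∧
    ℓ ∘ ⇑h = ConcatReverse α α ∧
    (IsCantorPath α ∨
      ∃ (α₁ : unitInterval → X) (x : X) (h' : unitInterval ≃ₜ unitInterval),
        StrictMono (⇑h') ∧ IsCantorPath α₁ ∧ α ∘ ⇑h' = PathConcat α₁ (fun _ => x))

/-- `β` is a `𝒰`-extension of `α` for `𝒰` a set of connected components of `𝒪(α)`. -/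
def UExtension {X : Type*} [TopologicalSpace X] (α β : unitInterval → X)
    (𝒰 : Set (Set ℝ)) : Prop :=
  (∀ J ∈ 𝒰, ∃ x ∈ Oset α, J = connectedComponentIn (Oset α) x) ∧
  (∀ t : unitInterval, (t : ℝ) ∉ ⋃₀ 𝒰 → β t = α t) ∧
  (∀ J ∈ 𝒰, IsCIPLoop (restrictIcc β (sInf J) (sSup J)))

/-- `α ⪯* β`: `β` is a `𝒰`-extension of `α` for some `𝒰 ⊆ lc(α)`. -/
def PrecExt {X : Type*} [TopologicalSpace X] (α β : unitInterval → X) : Prop :=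
  ∃ 𝒰 : Set (Set ℝ), UExtension α β 𝒰

/-- The sup-metric `ρ` on paths into a metric space. -/
def pathDist {X : Type*} [PseudoMetricSpace X] (α β : unitInterval → X) : ℝ :=
  ⨆ t : unitInterval, dist (α t) (β t)

/-- The image of a set `U ⊆ [0,1] ⊆ ℝ` under a self-homeomorphism of `[0,1]`. -/
def imageOnIcc (f : unitInterval ≃ₜ unitInterval) (U : Set ℝ) : Set ℝ :=
  Subtype.val '' (⇑f '' (Subtype.val ⁻¹' U))

/-- The Euclidean half-space of dimension `n` (all of `ℝ⁰` when `n = 0`). -/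
def halfSpace (n : ℕ) : Set (EuclideanSpace ℝ (Fin n)) :=
  {y | ∀ i : Fin n, (i : ℕ) = 0 → 0 ≤ y i}

/-- A topological manifold with (possibly empty) boundary: second countable, Hausdorff,
locally homeomorphic to open subsets of Euclidean half-spaces. -/
def IsTopManifold (M : Type*) [TopologicalSpace M] : Prop :=
  SecondCountableTopology M ∧ T2Space M ∧
  ∀ x : M, ∃ (n : ℕ) (U : Set M) (V : Set (halfSpace n)),
    U ∈ nhds x ∧ IsOpen V ∧ Nonempty (↥U ≃ₜ ↥V)

/-- The closed unit disk in the Euclidean plane. -/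
abbrev Disk2 : Type := ↥(Metric.closedBall (0 : EuclideanSpace ℝ (Fin 2)) 1)

end

section FourPoint

variable {T : Type*} [MetricSpace T]

/-- In a `0`-hyperbolic metric space, a preconnected set containing two points contains every point
metrically between them. -/
theorem IsPreconnected.mem_of_dist_add_dist_eq
    (h4 : ∀ a b c e : T, dist a b + dist c e ≤ max (dist a c + dist b e) (dist a e + dist b c))
    {S : Set T} (hS : IsPreconnected S) {x y z : T} (hx : x ∈ S) (hy : y ∈ S)
    (hz : dist x z + dist z y = dist x y) : z ∈ S := by
  by_contra hzS
  have hzx : z ≠ x := fun h => hzS (h ▸ hx)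
  have hzy : z ≠ y := fun h => hzS (h ▸ hy)
  let U : Set T := {v | dist v x < dist v z + dist z x}
  let V : Set T := {v | v ≠ z ∧ dist v x = dist v z + dist z x}
  have hU : IsOpen U := isOpen_lt (by fun_prop) (by fun_prop)
  have hV : IsOpen V := by
    rw [Metric.isOpen_iff]
    rintro v ⟨hvz, hv⟩
    refine ⟨dist v z, dist_pos.2 hvz, fun v' hv' => ?_⟩
    rw [Metric.mem_ball] at hv'
    refine ⟨fun h => ?_, ?_⟩
    · subst h
      rw [dist_comm] at hv'
      exact lt_irrefl _ hv'
    · have h := h4 v x z v'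
      have h1 := dist_triangle v' z x
      have h2 : 0 ≤ dist v' z := dist_nonneg
      rw [dist_comm v v', dist_comm x v', dist_comm x z, dist_comm z v'] at h
      rcases le_max_iff.1 h with h | h <;> linarith
  have hsub : S ⊆ U ∪ V := fun v hv => by
    rcases (dist_triangle v z x).lt_or_eq with h | h
    · exact Or.inl h
    · exact Or.inr ⟨fun h' => hzS (h' ▸ hv), h⟩
  obtain ⟨v, -, hvU, hvV⟩ := hS U V hU hV hsub
    ⟨x, hx, by simpa [U, dist_comm] using dist_pos.2 hzx.symm⟩
    ⟨y, hy, hzy.symm, by rw [dist_comm y x, dist_comm y z, dist_comm z x]; linarith⟩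
  exact absurd hvV.2 (ne_of_lt hvU)

/-- In a `0`-hyperbolic geodesic space any three points have a median. -/
theorem exists_median
    (hgeo : ∀ x y : T, ∃ γ : ℝ → T, γ 0 = x ∧ γ (dist x y) = y ∧
      ∀ s ∈ Set.Icc (0:ℝ) (dist x y), ∀ t ∈ Set.Icc (0:ℝ) (dist x y),
        dist (γ s) (γ t) = |s - t|)
    (h4 : ∀ a b c e : T, dist a b + dist c e ≤ max (dist a c + dist b e) (dist a e + dist b c))
    (x y w : T) : ∃ z, dist x z + dist z y = dist x y ∧ dist x z + dist z w = dist x w ∧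
      dist w z + dist z y = dist w y := by
  obtain ⟨γ, h0, h1, hγ⟩ := hgeo x y
  set k := (dist x y + dist x w - dist w y) / 2 with hk
  have a1 := dist_triangle x y w
  have a2 := dist_triangle x w y
  have a3 := dist_triangle w x y
  rw [dist_comm y w] at a1
  rw [dist_comm w x] at a3
  have hkm : k ∈ Set.Icc (0:ℝ) (dist x y) := ⟨by linarith, by linarith⟩
  have hxz : dist x (γ k) = k := by
    rw [← h0, hγ 0 ⟨le_rfl, dist_nonneg⟩ k hkm, zero_sub, abs_neg, abs_of_nonneg hkm.1]
  have hzy : dist (γ k) y = dist x y - k := by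
    conv_lhs => rw [← h1]
    rw [hγ k hkm _ ⟨dist_nonneg, le_rfl⟩, abs_sub_comm, abs_of_nonneg (by linarith [hkm.2])]
  have h := h4 w (γ k) x y
  have b1 := dist_triangle x (γ k) w
  have b2 := dist_triangle w (γ k) y
  rw [dist_comm w x, dist_comm (γ k) x] at h
  rw [dist_comm (γ k) w] at b1
  have h' : dist w (γ k) ≤ dist x w - k := by
    rcases le_max_iff.1 h with h | h <;> linarith
  refine ⟨γ k, by linarith, ?_, ?_⟩
  · rw [dist_comm (γ k) w]; linarith
  · linarith

theorem range_eq_of_injective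
    (hgeo : ∀ x y : T, ∃ γ : ℝ → T, γ 0 = x ∧ γ (dist x y) = y ∧
      ∀ s ∈ Set.Icc (0:ℝ) (dist x y), ∀ t ∈ Set.Icc (0:ℝ) (dist x y),
        dist (γ s) (γ t) = |s - t|)
    (h4 : ∀ a b c e : T, dist a b + dist c e ≤ max (dist a c + dist b e) (dist a e + dist b c))
    {q : unitInterval → T} (hq : Continuous q) (hinj : Function.Injective q) :
    Set.range q = {z | dist (q 0) z + dist z (q 1) = dist (q 0) (q 1)} := by
  apply Set.Subset.antisymm
  · rintro _ ⟨τ, rfl⟩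
    obtain ⟨z, hz, hz0, hz1⟩ := exists_median hgeo h4 (q 0) (q 1) (q τ)
    have c0 : z ∈ q '' Set.Icc 0 τ :=
      (isPreconnected_Icc.image q hq.continuousOn).mem_of_dist_add_dist_eq h4
        ⟨0, ⟨le_rfl, unitInterval.nonneg'⟩, rfl⟩ ⟨τ, ⟨unitInterval.nonneg', le_rfl⟩, rfl⟩ hz0
    have c1 : z ∈ q '' Set.Icc τ 1 :=
      (isPreconnected_Icc.image q hq.continuousOn).mem_of_dist_add_dist_eq h4
        ⟨τ, ⟨le_rfl, unitInterval.le_one'⟩, rfl⟩ ⟨1, ⟨unitInterval.le_one', le_rfl⟩, rfl⟩ hz1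
    obtain ⟨u, hu, rfl⟩ := c0
    obtain ⟨v, hv, hvu⟩ := c1
    have : u = τ := le_antisymm hu.2 (hinj hvu ▸ hv.1)
    exact this ▸ hz
  · intro z hz
    exact (isPreconnected_range hq).mem_of_dist_add_dist_eq h4 ⟨0, rfl⟩ ⟨1, rfl⟩ hz

end FourPoint

/-- A geodesic metric space satisfying the four-point condition is an ℝ-tree. -/
theorem isRTree_of_fourPoint {T : Type} [MetricSpace T] [Nonempty T]
    (hgeo : ∀ x y : T, ∃ γ : ℝ → T, γ 0 = x ∧ γ (dist x y) = y ∧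
      ∀ s ∈ Set.Icc (0:ℝ) (dist x y), ∀ t ∈ Set.Icc (0:ℝ) (dist x y),
        dist (γ s) (γ t) = |s - t|)
    (h4 : ∀ a b c e : T, dist a b + dist c e ≤ max (dist a c + dist b e) (dist a e + dist b c)) :
    IsRTree T where
  nonempty := inferInstance
  geodesic := hgeo
  uniquelyArcwise p q hp hq hpi hqi h0 h1 := by
    rw [range_eq_of_injective hgeo h4 hp hpi, range_eq_of_injective hgeo h4 hq hqi, h0, h1]
  locallyArcwise := by
    refine LocallyPathConnectedSpace.of_bases (fun x => Metric.nhds_basis_ball) fun x ε hε => ?_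
    refine ⟨x, Metric.mem_ball_self hε, fun {y} hy => ?_⟩
    obtain ⟨γ, h0, h1, hγ⟩ := hgeo x y
    have hc : ContinuousOn γ (Set.Icc 0 (dist x y)) := by
      refine LipschitzOnWith.continuousOn (K := 1) ?_
      refine LipschitzOnWith.of_dist_le_mul fun s hs t ht => ?_
      simp [hγ s hs t ht, Real.dist_eq]
    refine JoinedIn.mono (U := γ '' Set.Icc 0 (dist x y)) ?_ ?_
    · have := (convex_Icc (0:ℝ) (dist x y)).isPathConnected ⟨0, le_rfl, dist_nonneg⟩
      have := this.image' hc
      exact this.joinedIn x ⟨0, ⟨le_rfl, dist_nonneg⟩, h0⟩ y ⟨_, ⟨dist_nonneg, le_rfl⟩, h1⟩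
    · rintro _ ⟨s, hs, rfl⟩
      rw [Metric.mem_ball, ← h0, hγ s hs 0 ⟨le_rfl, dist_nonneg⟩, sub_zero, abs_of_nonneg hs.1]
      rw [Metric.mem_ball, dist_comm] at hy
      exact hs.2.trans_lt hy

section Contour

/-- The minimum of a real function over the interval between two points. -/
noncomputable def intervalMin (g : ℝ → ℝ) (s t : ℝ) : ℝ := sInf (g '' Set.uIcc s t)

variable {g : ℝ → ℝ}

theorem intervalMin_comm (s t : ℝ) : intervalMin g s t = intervalMin g t s := by
  rw [intervalMin, Set.uIcc_comm, intervalMin]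

theorem intervalMin_self (s : ℝ) : intervalMin g s s = g s := by
  simp [intervalMin]

theorem exists_intervalMin_eq (hg : Continuous g) (s t : ℝ) :
    ∃ u ∈ Set.uIcc s t, intervalMin g s t = g u :=
  isCompact_uIcc.exists_sInf_image_eq Set.nonempty_uIcc hg.continuousOn

theorem intervalMin_le (hg : Continuous g) {s t u : ℝ} (hu : u ∈ Set.uIcc s t) :
    intervalMin g s t ≤ g u :=
  csInf_le (isCompact_uIcc.image hg).bddBelow ⟨u, hu, rfl⟩

theorem le_intervalMin (hg : Continuous g) {s t h : ℝ} (H : ∀ u ∈ Set.uIcc s t, h ≤ g u) :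
    h ≤ intervalMin g s t := by
  obtain ⟨u, hu, h'⟩ := exists_intervalMin_eq hg s t
  exact h' ▸ H u hu

theorem intervalMin_le_left (hg : Continuous g) (s t : ℝ) : intervalMin g s t ≤ g s :=
  intervalMin_le hg Set.left_mem_uIcc

theorem intervalMin_le_right (hg : Continuous g) (s t : ℝ) : intervalMin g s t ≤ g t :=
  intervalMin_le hg Set.right_mem_uIcc

theorem min_intervalMin_le (hg : Continuous g) (s t u : ℝ) :
    min (intervalMin g s t) (intervalMin g t u) ≤ intervalMin g s u := by
  refine le_intervalMin hg fun v hv => ?_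
  rcases Set.uIcc_subset_uIcc_union_uIcc hv with h | h
  · exact (min_le_left _ _).trans (intervalMin_le hg h)
  · exact (min_le_right _ _).trans (intervalMin_le hg h)

/-- The pseudodistance on the parameter interval of a tree with contour function `g`. -/
noncomputable def contourDist (g : ℝ → ℝ) (s t : ℝ) : ℝ := g s + g t - 2 * intervalMin g s t

theorem contourDist_comm (s t : ℝ) : contourDist g s t = contourDist g t s := by
  rw [contourDist, contourDist, intervalMin_comm]; ring

theorem contourDist_triangle (hg : Continuous g) (s t u : ℝ) :
    contourDist g s u ≤ contourDist g s t + contourDist g t u := by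
  have h1 := min_intervalMin_le hg s t u
  have h2 := intervalMin_le_right hg s t
  have h3 := intervalMin_le_left hg t u
  simp only [contourDist]
  rcases min_le_iff.1 h1 with h | h <;> linarith

theorem contourDist_fourPoint (hg : Continuous g) (a b c e : ℝ) :
    contourDist g a b + contourDist g c e ≤
      max (contourDist g a c + contourDist g b e) (contourDist g a e + contourDist g b c) := by
  have h1 := min_intervalMin_le hg a c b
  have h2 := min_intervalMin_le hg a e b
  have h3 := min_intervalMin_le hg c a e
  have h4 := min_intervalMin_le hg c b e
  rw [intervalMin_comm c b] at h1
  rw [intervalMin_comm e b] at h2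
  rw [intervalMin_comm c a] at h3
  rw [intervalMin_comm c b] at h4
  simp only [contourDist]
  rw [le_max_iff]
  by_contra! h
  obtain ⟨h5, h6⟩ := h
  rcases min_le_iff.1 h1 with h1 | h1 <;> rcases min_le_iff.1 h2 with h2 | h2 <;>
    rcases min_le_iff.1 h3 with h3 | h3 <;> rcases min_le_iff.1 h4 with h4 | h4 <;> linarith

theorem tendsto_contourDist (hg : Continuous g) (s : ℝ) :
    Tendsto (fun t => contourDist g t s) (𝓝 s) (𝓝 0) := by
  rw [Metric.tendsto_nhds_nhds]
  intro ε hε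
  obtain ⟨δ, hδ, H⟩ := Metric.continuous_iff.1 hg s (ε / 3) (by positivity)
  refine ⟨δ, hδ, fun {t} ht => ?_⟩
  obtain ⟨u, hu, h⟩ := exists_intervalMin_eq hg t s
  have h1 := H t ht
  have h2 := H u (by
    rw [Real.dist_eq] at ht ⊢
    rw [abs_sub_comm] at ht ⊢
    exact (Set.abs_sub_right_of_mem_uIcc hu).trans_lt ht)
  rw [Real.dist_eq, abs_lt] at *
  constructor <;> simp only [contourDist, h] <;> linarith [h1.1, h1.2, h2.1, h2.2]

/-- Every height between the values at the ends of an interval has a last occurrence. -/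
theorem exists_ancestor (hg : Continuous g) {a t h : ℝ} (hat : a ≤ t) (ha : g a ≤ h)
    (ht : h ≤ g t) : ∃ l ∈ Set.Icc a t, g l = h ∧ ∀ u ∈ Set.Icc l t, h ≤ g u := by
  obtain ⟨l, ⟨hl, hlh⟩, hmax⟩ := (isCompact_Icc.inter_right
    (isClosed_le hg continuous_const)).exists_isGreatest
    (s := Set.Icc a t ∩ {u | g u ≤ h}) ⟨a, ⟨le_rfl, hat⟩, ha⟩
  have hgl : g l = h := by
    obtain ⟨v, hv, hvh⟩ := intermediate_value_Icc hl.2 hg.continuousOn ⟨hlh, ht⟩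
    have := hmax ⟨⟨hl.1.trans hv.1, hv.2⟩, hvh.le⟩
    rw [← hvh, le_antisymm this hv.1]
  refine ⟨l, hl, hgl, fun u hu => ?_⟩
  by_contra! hlt
  have := hmax ⟨⟨hl.1.trans hu.1, hu.2⟩, hlt.le⟩
  rw [le_antisymm this hu.1, hgl] at hlt
  exact lt_irrefl _ hlt

theorem intervalMin_of_ancestors (hg : Continuous g) {s l l' : ℝ} (h : intervalMin g l s = g l)
    (h' : intervalMin g l' s = g l') : intervalMin g l l' = min (g l) (g l') := by
  refine le_antisymm (le_min (intervalMin_le_left hg _ _) (intervalMin_le_right hg _ _)) ?_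
  have := min_intervalMin_le hg l s l'
  rwa [h, intervalMin_comm s, h'] at this

theorem contourDist_of_ancestors (hg : Continuous g) {s l l' : ℝ} (h : intervalMin g l s = g l)
    (h' : intervalMin g l' s = g l') : contourDist g l l' = |g l - g l'| := by
  rw [contourDist, intervalMin_of_ancestors hg h h']
  rcases le_total (g l) (g l') with hl | hl
  · rw [min_eq_left hl, abs_of_nonpos (by linarith)]; ring
  · rw [min_eq_right hl, abs_of_nonneg (by linarith)]; ring

theorem contourDist_of_ancestors_of_le (hg : Continuous g) {s t l l' : ℝ}
    (h : intervalMin g l s = g l) (h' : intervalMin g l' t = g l')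
    (hl : intervalMin g s t ≤ g l) (hl' : intervalMin g s t ≤ g l') :
    contourDist g l l' = g l + g l' - 2 * intervalMin g s t := by
  rw [contourDist]
  congr 2
  have h1 := min_intervalMin_le hg l s l'
  have h2 := min_intervalMin_le hg s t l'
  have h3 := min_intervalMin_le hg s l t
  have h4 := min_intervalMin_le hg l l' t
  have h5 := intervalMin_le_left hg l l'
  have h6 := intervalMin_le_right hg l l'
  rw [h] at h1
  rw [intervalMin_comm t l', h'] at h2
  rw [intervalMin_comm s l, h] at h3
  rw [h'] at h4
  grind

/-- The parameter interval of a contour function, with its tree pseudometric. -/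
def ContourSpace (_ : C(ℝ, ℝ)) : Type := unitInterval

/-- The underlying parameter of a point of the contour space. -/
def ContourSpace.param {g : C(ℝ, ℝ)} (s : ContourSpace g) : unitInterval := s

noncomputable instance (g : C(ℝ, ℝ)) : PseudoMetricSpace (ContourSpace g) where
  dist s t := contourDist g s.param t.param
  dist_self s := by simp only [contourDist, intervalMin_self]; ring
  dist_comm s t := contourDist_comm _ _
  dist_triangle s t u := contourDist_triangle g.continuous _ _ _

/-- The ℝ-tree coded by a contour function. -/
abbrev ContourTree (g : C(ℝ, ℝ)) : Type := SeparationQuotient (ContourSpace g)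

/-- The contour path around the tree. -/
noncomputable def contourPath (g : C(ℝ, ℝ)) (t : unitInterval) : ContourTree g :=
  SeparationQuotient.mk (X := ContourSpace g) t

theorem dist_contourPath (g : C(ℝ, ℝ)) (s t : unitInterval) :
    dist (contourPath g s) (contourPath g t) = contourDist g s t := rfl

theorem contourPath_surjective (g : C(ℝ, ℝ)) : Function.Surjective (contourPath g) :=
  fun x => by
    obtain ⟨s, hs⟩ := SeparationQuotient.surjective_mk (X := ContourSpace g) x
    exact ⟨s.param, hs⟩

theorem continuous_contourPath (g : C(ℝ, ℝ)) : Continuous (contourPath g) := by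
  rw [continuous_iff_continuousAt]
  intro s
  rw [ContinuousAt, tendsto_iff_dist_tendsto_zero]
  exact (tendsto_contourDist g.continuous s).comp continuous_subtype_val.continuousAt

theorem isQuotientMap_contourPath (g : C(ℝ, ℝ)) : IsQuotientMap (contourPath g) :=
  (continuous_contourPath g).isClosedMap.isQuotientMap (continuous_contourPath g)
    (contourPath_surjective g)

/-- An ancestor, as a point of the parameter interval. -/
theorem exists_ancestor_unitInterval (g : C(ℝ, ℝ)) (t : unitInterval) {h : ℝ} (h0 : g 0 ≤ h)
    (ht : h ≤ g t) : ∃ l : unitInterval, g l = h ∧ intervalMin g l t = g l ∧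
      ∀ u ∈ Set.Icc (l : ℝ) t, h ≤ g u := by
  obtain ⟨l, hl, hgl, hu⟩ := exists_ancestor g.continuous t.2.1 h0 ht
  refine ⟨⟨l, hl.1, hl.2.trans t.2.2⟩, hgl, ?_, hu⟩
  refine le_antisymm (intervalMin_le_left g.continuous _ _) (le_intervalMin g.continuous ?_)
  rw [Set.uIcc_of_le hl.2]
  exact fun u hu' => hgl.trans_le (hu u hu')

theorem isRTree_contourTree (g : C(ℝ, ℝ)) (hg : ∀ t ∈ unitInterval, g 0 ≤ g t) :
    IsRTree (ContourTree g) := by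
  have : Nonempty (ContourTree g) := ⟨contourPath g 0⟩
  refine isRTree_of_fourPoint (fun x y => ?_) fun a b c e => ?_
  · obtain ⟨s, rfl⟩ := contourPath_surjective g x
    obtain ⟨t, rfl⟩ := contourPath_surjective g y
    rw [dist_contourPath]
    have hgc := g.continuous
    set m := intervalMin g s t with hm
    have hms : m ≤ g s := intervalMin_le_left hgc _ _
    have hmt : m ≤ g t := intervalMin_le_right hgc _ _
    have hm0 : g 0 ≤ m := le_intervalMin hgc fun u hu =>
      hg u (Set.ordConnected_Icc.uIcc_subset s.2 t.2 hu)
    have hA : ∀ h, ∃ l : unitInterval, h ∈ Set.Icc m (g s) →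
        g l = h ∧ intervalMin g l s = g l := fun h => by
      by_cases hh : h ∈ Set.Icc m (g s)
      · obtain ⟨l, hl⟩ := exists_ancestor_unitInterval g s (hm0.trans hh.1) hh.2
        exact ⟨l, fun _ => ⟨hl.1, hl.2.1⟩⟩
      · exact ⟨0, fun h => absurd h hh⟩
    have hB : ∀ h, ∃ l : unitInterval, h ∈ Set.Icc m (g t) →
        g l = h ∧ intervalMin g l t = g l := fun h => by
      by_cases hh : h ∈ Set.Icc m (g t)
      · obtain ⟨l, hl⟩ := exists_ancestor_unitInterval g t (hm0.trans hh.1) hh.2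
        exact ⟨l, fun _ => ⟨hl.1, hl.2.1⟩⟩
      · exact ⟨0, fun h => absurd h hh⟩
    choose A hA using hA
    choose B hB using hB
    have hD : contourDist g s t = g s + g t - 2 * m := rfl
    rw [hD]
    let c : ℝ → unitInterval := fun τ =>
      if τ ≤ g s - m then A (g s - τ) else B (τ - g s + 2 * m)
    have hc1 : ∀ τ, 0 ≤ τ → τ ≤ g s - m → g (c τ) = g s - τ ∧ intervalMin g (c τ) s = g (c τ) := by
      intro τ h0 h1
      simp only [c, if_pos h1]
      exact hA _ ⟨by linarith, by linarith⟩
    have hc2 : ∀ τ, ¬ τ ≤ g s - m → τ ≤ g s + g t - 2 * m →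
        g (c τ) = τ - g s + 2 * m ∧ intervalMin g (c τ) t = g (c τ) := by
      intro τ h0 h1
      simp only [c, if_neg h0]
      push Not at h0
      exact hB _ ⟨by linarith, by linarith⟩
    have key : ∀ σ ∈ Set.Icc 0 (g s + g t - 2 * m), ∀ τ ∈ Set.Icc 0 (g s + g t - 2 * m), σ ≤ τ →
        contourDist g (c σ) (c τ) = τ - σ := by
      intro σ hσ τ hτ hle
      by_cases h1 : σ ≤ g s - m
      · obtain ⟨e1, e1'⟩ := hc1 σ hσ.1 h1
        by_cases h2 : τ ≤ g s - m
        · obtain ⟨e2, e2'⟩ := hc1 τ hτ.1 h2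
          rw [contourDist_of_ancestors hgc e1' e2', e1, e2, abs_of_nonneg (by linarith)]
          ring
        · obtain ⟨e2, e2'⟩ := hc2 τ h2 hτ.2
          rw [contourDist_of_ancestors_of_le hgc e1' e2' (by linarith) (by linarith), e1, e2]
          linarith
      · have h2 : ¬ τ ≤ g s - m := fun h => h1 (hle.trans h)
        obtain ⟨e1, e1'⟩ := hc2 σ h1 hσ.2
        obtain ⟨e2, e2'⟩ := hc2 τ h2 hτ.2
        rw [contourDist_of_ancestors hgc e1' e2', e1, e2, abs_of_nonpos (by linarith)]
        ring
    refine ⟨fun τ => contourPath g (c τ), ?_, ?_, fun σ hσ τ hτ => ?_⟩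
    · obtain ⟨e, e'⟩ := hc1 0 le_rfl (by linarith)
      rw [← dist_eq_zero, dist_contourPath, contourDist, e', e]
      ring
    · rw [← dist_eq_zero, dist_contourPath]
      by_cases h : g s + g t - 2 * m ≤ g s - m
      · obtain ⟨e, e'⟩ := hc1 _ (by linarith) h
        rw [contourDist_of_ancestors_of_le hgc e' (intervalMin_self _) (by linarith)
          (by linarith), e]
        linarith
      · obtain ⟨e, e'⟩ := hc2 _ h le_rfl
        rw [contourDist, e', e]
        ring
    · rcases le_total σ τ with h | h
      · rw [dist_contourPath, key σ hσ τ hτ h, abs_of_nonpos (by linarith)]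
        ring
      · rw [dist_contourPath, contourDist_comm, key τ hτ σ hσ h, abs_of_nonneg (by linarith)]
  · obtain ⟨a, rfl⟩ := contourPath_surjective g a
    obtain ⟨b, rfl⟩ := contourPath_surjective g b
    obtain ⟨c, rfl⟩ := contourPath_surjective g c
    obtain ⟨e, rfl⟩ := contourPath_surjective g e
    exact contourDist_fourPoint g.continuous _ _ _ _

/-- A path that factors through the tree of a contour function rising from `0` to `1` reduces to
its restriction to the last occurrences of the heights. -/
theorem geodesicReduction_of_contour {X : Type*} [TopologicalSpace X] (g : C(ℝ, ℝ))
    (hg : ∀ t ∈ unitInterval, 0 ≤ g t) (g0 : g 0 = 0) (g1 : g 1 = 1)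
    {γ : unitInterval → X} (hγ : Continuous γ)
    (hpair : ∀ s t : unitInterval, s ≤ t → g s = g t → (∀ u ∈ Set.Icc (s : ℝ) t, g s ≤ g u) →
      γ s = γ t)
    {β : unitInterval → X}
    (htrunk : ∀ s h : unitInterval, g s = h → (∀ u ∈ Set.Icc (s : ℝ) 1, g s ≤ g u) → γ s = β h) :
    GeodesicReduction γ β := by
  have hgc := g.continuous
  have hwd : ∀ s t : unitInterval, contourPath g s = contourPath g t → γ s = γ t := by
    intro s t hst
    wlog hle : s ≤ t generalizing s t
    · exact (this t s hst.symm (le_of_not_ge hle)).symm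
    rw [← dist_eq_zero, dist_contourPath, contourDist] at hst
    have h1 := intervalMin_le_left hgc s t
    have h2 := intervalMin_le_right hgc s t
    refine hpair s t hle (by linarith) fun u hu => ?_
    have h3 := intervalMin_le hgc (Set.Icc_subset_uIcc hu)
    linarith
  have hr : ∀ h : unitInterval, ∃ l : unitInterval, g l = h ∧ intervalMin g l (1 : unitInterval) = g l ∧
      ∀ u ∈ Set.Icc (l : ℝ) (1 : unitInterval), (h : ℝ) ≤ g u := fun h =>
    exists_ancestor_unitInterval g 1 (g0.trans_le h.2.1) (h.2.2.trans_eq g1.symm)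
  choose l hl hlm hlu using hr
  have hdist : ∀ h h' : unitInterval, dist (contourPath g (l h)) (contourPath g (l h')) =
      dist h h' := fun h h' => by
    rw [dist_contourPath, contourDist_of_ancestors hgc (hlm h) (hlm h'), hl, hl, Subtype.dist_eq,
      Real.dist_eq]
  have hiso : Isometry fun h => contourPath g (l h) := Isometry.of_dist_eq hdist
  let f : ContourTree g → X := fun x => γ (Function.surjInv (contourPath_surjective g) x)
  have hf : ∀ t, f (contourPath g t) = γ t := fun t =>
    hwd _ _ (Function.surjInv_eq (contourPath_surjective g) _)
  have hfp : f ∘ contourPath g = γ := funext hf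
  refine ⟨ContourTree g, inferInstance, isRTree_contourTree g (fun t ht => g0.trans_le (hg t ht)),
    f, contourPath g, fun h => contourPath g (l h), ?_, continuous_contourPath g,
    hiso.continuous, hiso.injective, ?_, ?_, hfp, ?_⟩
  · rw [(isQuotientMap_contourPath g).continuous_iff, hfp]
    exact hγ
  · rw [← dist_eq_zero, dist_contourPath]
    have h0 : g ((0 : unitInterval) : ℝ) = 0 := g0
    have hl0 : g (l 0) = 0 := hl 0
    have : 0 ≤ intervalMin g (l 0) (0 : unitInterval) := le_intervalMin hgc fun u hu =>
      hg u (Set.ordConnected_Icc.uIcc_subset (l 0).2 (0 : unitInterval).2 hu)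
    refine le_antisymm ?_ (dist_contourPath g (l 0) 0 ▸ dist_nonneg)
    rw [contourDist, h0, hl0]
    linarith
  · have h1 : g ((1 : unitInterval) : ℝ) = 1 := g1
    have hl1 : g (l 1) = 1 := hl 1
    rw [← dist_eq_zero, dist_contourPath, contourDist, hlm, h1, hl1]
    ring
  · ext h
    exact (hf (l h)).trans (htrunk _ _ (hl h) fun u hu => (hl h).trans_le (hlu h u hu))

end Contour

section SelfSimilar

/-- Existence of continuous fixed points of contracting operators on functions on the line that
are `0` to the left and `e` to the right of the unit interval. -/
theorem exists_continuous_fixedPoint {E : Type*} [NormedAddCommGroup E] [NormedSpace ℝ E]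
    [CompleteSpace E] (e : E) (Φ : (ℝ → E) → ℝ → E) {K : ℝ} (hK0 : 0 ≤ K) (hK1 : K < 1)
    (hcont : ∀ u, Continuous u → Continuous (Φ u))
    (hbdry : ∀ u, (∀ t ≤ 0, u t = 0) → (∀ t, 1 ≤ t → u t = e) →
      (∀ t ≤ 0, Φ u t = 0) ∧ ∀ t, 1 ≤ t → Φ u t = e)
    (hcontr : ∀ u v, (∀ t ≤ 0, u t = 0) → (∀ t, 1 ≤ t → u t = e) → (∀ t ≤ 0, v t = 0) →
      (∀ t, 1 ≤ t → v t = e) → ∀ C, (∀ t, dist (u t) (v t) ≤ C) →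
      ∀ t, dist (Φ u t) (Φ v t) ≤ K * C) :
    ∃ u, Continuous u ∧ (∀ t ≤ 0, u t = 0) ∧ (∀ t, 1 ≤ t → u t = e) ∧ ∀ t, Φ u t = u t := by
  let u : ℕ → ℝ → E := fun n =>
    Φ^[n] fun t => ((Set.projIcc (0:ℝ) 1 zero_le_one t : unitInterval) : ℝ) • e
  have hsucc : ∀ n, u (n + 1) = Φ (u n) := fun n => Function.iterate_succ_apply' _ _ _
  have hu : ∀ n, Continuous (u n) ∧ (∀ t ≤ 0, u n t = 0) ∧ ∀ t, 1 ≤ t → u n t = e := by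
    intro n
    induction n with
    | zero =>
      refine ⟨?_, fun t ht => ?_, fun t ht => ?_⟩
      · exact (continuous_subtype_val.comp continuous_projIcc).smul continuous_const
      · simp [u, Set.projIcc_of_le_left _ ht]
      · simp [u, Set.projIcc_of_right_le _ ht]
    | succ n ih =>
      rw [hsucc]
      exact ⟨hcont _ ih.1, hbdry _ ih.2.1 ih.2.2⟩
  obtain ⟨C, hC⟩ : ∃ C, ∀ t, dist (u 0 t) (u 1 t) ≤ C := by
    obtain ⟨C, hC⟩ := (isCompact_Icc (a := (0:ℝ)) (b := 1)).exists_bound_of_continuousOn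
      (((hu 0).1.sub (hu 1).1).continuousOn)
    refine ⟨max C 0, fun t => ?_⟩
    rcases le_total t 0 with h0 | h0
    · simp [(hu 0).2.1 t h0, (hu 1).2.1 t h0]
    rcases le_total 1 t with h1 | h1
    · simp [(hu 0).2.2 t h1, (hu 1).2.2 t h1]
    exact (dist_eq_norm _ _).trans_le ((hC t ⟨h0, h1⟩).trans (le_max_left _ _))
  have hstep : ∀ n t, dist (u n t) (u (n + 1) t) ≤ C * K ^ n := by
    intro n
    induction n with
    | zero => simpa using hC
    | succ n ih =>
      intro t
      have := hcontr (u n) (u (n + 1)) (hu n).2.1 (hu n).2.2 (hu _).2.1 (hu _).2.2 _ ih t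
      rw [← hsucc, ← hsucc] at this
      exact this.trans_eq (by ring)
  choose v hv using fun t =>
    cauchySeq_tendsto_of_complete (cauchySeq_of_le_geometric K C hK1 fun n => hstep n t)
  have hbound : ∀ n t, dist (u n t) (v t) ≤ C * K ^ n / (1 - K) := fun n t =>
    dist_le_of_le_geometric_of_tendsto K C hK1 (fun n => hstep n t) (hv t) n
  have hlim : Tendsto (fun n : ℕ => C * K ^ n / (1 - K)) atTop (𝓝 0) := by
    simpa using ((tendsto_pow_atTop_nhds_zero_of_lt_one hK0 hK1).const_mul C).div_const (1 - K)
  have hv0 : ∀ t ≤ 0, v t = 0 := fun t ht =>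
    tendsto_nhds_unique (hv t) (by simp [(hu _).2.1 t ht])
  have hv1 : ∀ t, 1 ≤ t → v t = e := fun t ht =>
    tendsto_nhds_unique (hv t) (by simp [(hu _).2.2 t ht])
  refine ⟨v, ?_, hv0, hv1, fun t => ?_⟩
  · have : TendstoUniformly u v atTop := by
      rw [Metric.tendstoUniformly_iff]
      intro ε hε
      filter_upwards [hlim.eventually_lt_const hε] with n hn t
      rw [dist_comm]
      exact (hbound n t).trans_lt hn
    exact this.continuous (Frequently.of_forall fun n => (hu n).1)
  · refine tendsto_nhds_unique (f := fun n => u (n + 1) t) ?_ ((tendsto_add_atTop_iff_nat 1).2 (hv t))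
    rw [tendsto_iff_dist_tendsto_zero]
    refine squeeze_zero (fun _ => dist_nonneg) (fun n => ?_) (by simpa using hlim.const_mul K)
    rw [hsucc]
    exact hcontr _ _ (hu n).2.1 (hu n).2.2 hv0 hv1 _ (hbound n) t

/-- The self-similarity relations of the hypotenuse contour function. -/
structure IsHypotenuseContour (g : ℝ → ℝ) : Prop where
  continuous : Continuous g
  left : ∀ t ≤ 0, g t = 0
  right : ∀ t, 1 ≤ t → g t = 1
  fst : ∀ t ∈ Set.Icc (0:ℝ) 1, g (t / 4) = g t / 2
  snd : ∀ t ∈ Set.Icc (0:ℝ) 1, g ((1 + t) / 4) = 1 / 2 + g t / 2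
  trd : ∀ t ∈ Set.Icc (0:ℝ) 1, g ((3 - t) / 4) = 1 / 2 + g t / 2
  fth : ∀ t ∈ Set.Icc (0:ℝ) 1, g ((3 + t) / 4) = 1 / 2 + g t / 2

/-- The self-similarity relations of the Sierpiński-Knopp curve. -/
structure IsSierpinskiCurve (γ : ℝ → ℂ) : Prop where
  continuous : Continuous γ
  zero : γ 0 = 0
  half : ∀ t ∈ Set.Icc (0:ℝ) 1, γ (t / 2) = (1 + Complex.I) / 2 * (starRingEnd ℂ) (γ t)
  reverse : ∀ t, γ (1 - t) = 1 - (starRingEnd ℂ) (γ t)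

/-- The Sierpiński-Knopp curve filling the right isosceles triangle with hypotenuse `[0, 1]`. -/
theorem exists_isSierpinskiCurve : ∃ γ : ℝ → ℂ, IsSierpinskiCurve γ := by
  have hn : ‖(1 + Complex.I) / 2‖ ≤ 3 / 4 := by
    rw [Complex.norm_eq_sqrt_sq_add_sq]
    apply Real.sqrt_le_iff.2
    norm_num
  have hn' : ‖(1 - Complex.I) / 2‖ ≤ 3 / 4 := by
    rw [Complex.norm_eq_sqrt_sq_add_sq]
    apply Real.sqrt_le_iff.2
    norm_num
  obtain ⟨γ, hγ, h0, h1, hΦ⟩ := exists_continuous_fixedPoint (1 : ℂ)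
    (fun u t => (1 + Complex.I) / 2 * (starRingEnd ℂ) (u (2 * t)) +
      (1 - Complex.I) / 2 * (1 - u (2 - 2 * t))) (K := 3 / 4) (by norm_num) (by norm_num)
    (fun u hu => by fun_prop)
    (fun u h0 h1 => ⟨fun t ht => by
        rw [h0 (2 * t) (by linarith), h1 (2 - 2 * t) (by linarith)]; simp,
      fun t ht => by
        rw [h1 (2 * t) (by linarith), h0 (2 - 2 * t) (by linarith)]; simp; ring⟩)
    (fun u v hu0 hu1 hv0 hv1 C hC t => by
      rcases le_total t (1 / 2) with ht | ht
      · rw [hu1 (2 - 2 * t) (by linarith), hv1 (2 - 2 * t) (by linarith), dist_eq_norm,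
          add_sub_add_right_eq_sub, ← mul_sub, ← map_sub, norm_mul, RCLike.norm_conj,
          ← dist_eq_norm]
        exact mul_le_mul hn (hC _) dist_nonneg (by norm_num)
      · rw [hu1 (2 * t) (by linarith), hv1 (2 * t) (by linarith), dist_eq_norm,
          add_sub_add_left_eq_sub, ← mul_sub, sub_sub_sub_cancel_left, norm_mul, norm_sub_rev,
          ← dist_eq_norm]
        exact mul_le_mul hn' (hC _) dist_nonneg (by norm_num))
  refine ⟨γ, hγ, h0 0 le_rfl, fun t ht => ?_, fun t => ?_⟩
  · rw [← hΦ (t / 2), h1 (2 - 2 * (t / 2)) (by linarith [ht.2])]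
    simp [mul_div_cancel₀]
  · rw [← hΦ (1 - t), ← hΦ t]
    simp only [map_add, map_mul, map_sub, map_div₀, map_one, Complex.conj_I, map_ofNat,
      Complex.conj_conj]
    rw [show 2 * (1 - t) = 2 - 2 * t by ring, show 2 - (2 - 2 * t) = 2 * t by ring]
    ring

/-- The contour function of the tree of segments traversed by the Sierpiński-Knopp curve whose
trunk is the hypotenuse. -/
theorem exists_isHypotenuseContour : ∃ g : ℝ → ℝ, IsHypotenuseContour g := by
  obtain ⟨g, hg, h0, h1, hΦ⟩ := exists_continuous_fixedPoint (1 : ℝ)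
    (fun u t => (u (4 * t) + u (4 * t - 1) + (u (3 - 4 * t) - 1) + u (4 * t - 3)) / 2)
    (K := 1 / 2) (by norm_num) (by norm_num)
    (fun u hu => by fun_prop)
    (fun u h0 h1 => ⟨fun t ht => by
        rw [h0 (4 * t) (by linarith), h0 (4 * t - 1) (by linarith), h1 (3 - 4 * t) (by linarith),
          h0 (4 * t - 3) (by linarith)]; norm_num,
      fun t ht => by
        rw [h1 (4 * t) (by linarith), h1 (4 * t - 1) (by linarith), h0 (3 - 4 * t) (by linarith),
          h1 (4 * t - 3) (by linarith)]; norm_num⟩)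
    (fun u v hu0 hu1 hv0 hv1 C hC t => by
      have c1 := abs_le.1 (hC (4 * t))
      have c2 := abs_le.1 (hC (4 * t - 1))
      have c3 := abs_le.1 (hC (3 - 4 * t))
      have c4 := abs_le.1 (hC (4 * t - 3))
      have d1 : 1 / 4 ≤ t → u (4 * t) = 1 ∧ v (4 * t) = 1 := fun h =>
        ⟨hu1 _ (by linarith), hv1 _ (by linarith)⟩
      have d2 : 1 / 2 ≤ t → u (4 * t - 1) = 1 ∧ v (4 * t - 1) = 1 := fun h =>
        ⟨hu1 _ (by linarith), hv1 _ (by linarith)⟩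
      have d3 : t ≤ 1 / 4 → u (4 * t - 1) = 0 ∧ v (4 * t - 1) = 0 := fun h =>
        ⟨hu0 _ (by linarith), hv0 _ (by linarith)⟩
      have d4 : t ≤ 1 / 2 → u (3 - 4 * t) = 1 ∧ v (3 - 4 * t) = 1 := fun h =>
        ⟨hu1 _ (by linarith), hv1 _ (by linarith)⟩
      have d5 : 3 / 4 ≤ t → u (3 - 4 * t) = 0 ∧ v (3 - 4 * t) = 0 := fun h =>
        ⟨hu0 _ (by linarith), hv0 _ (by linarith)⟩
      have d6 : t ≤ 3 / 4 → u (4 * t - 3) = 0 ∧ v (4 * t - 3) = 0 := fun h =>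
        ⟨hu0 _ (by linarith), hv0 _ (by linarith)⟩
      rw [Real.dist_eq, abs_le]
      rcases le_total t (1 / 4) with e1 | e1
      · obtain ⟨d3, d3'⟩ := d3 e1
        obtain ⟨d4, d4'⟩ := d4 (by linarith)
        obtain ⟨d6, d6'⟩ := d6 (by linarith)
        constructor <;> linarith
      obtain ⟨d1, d1'⟩ := d1 e1
      rcases le_total t (1 / 2) with e2 | e2
      · obtain ⟨d4, d4'⟩ := d4 (by linarith)
        obtain ⟨d6, d6'⟩ := d6 (by linarith)
        constructor <;> linarith
      obtain ⟨d2, d2'⟩ := d2 e2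
      rcases le_total t (3 / 4) with e3 | e3
      · obtain ⟨d6, d6'⟩ := d6 (by linarith)
        constructor <;> linarith
      · obtain ⟨d5, d5'⟩ := d5 (by linarith)
        constructor <;> linarith)
  refine ⟨g, hg, h0, h1, ?_, ?_, ?_, ?_⟩ <;> rintro t ⟨ht0, ht1⟩
  · rw [← hΦ (t / 4), h0 (4 * (t / 4) - 1) (by linarith), h1 (3 - 4 * (t / 4)) (by linarith),
      h0 (4 * (t / 4) - 3) (by linarith), show 4 * (t / 4) = t by ring]
    ring
  · rw [← hΦ ((1 + t) / 4), h1 (4 * ((1 + t) / 4)) (by linarith),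
      show 4 * ((1 + t) / 4) - 1 = t by ring, h1 (3 - 4 * ((1 + t) / 4)) (by linarith),
      h0 (4 * ((1 + t) / 4) - 3) (by linarith)]
    ring
  · rw [← hΦ ((3 - t) / 4), h1 (4 * ((3 - t) / 4)) (by linarith),
      h1 (4 * ((3 - t) / 4) - 1) (by linarith), show 3 - 4 * ((3 - t) / 4) = t by ring,
      h0 (4 * ((3 - t) / 4) - 3) (by linarith)]
    ring
  · rw [← hΦ ((3 + t) / 4), h1 (4 * ((3 + t) / 4)) (by linarith),
      h1 (4 * ((3 + t) / 4) - 1) (by linarith), h0 (3 - 4 * ((3 + t) / 4)) (by linarith),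
      show 4 * ((3 + t) / 4) - 3 = t by ring]
    ring

end SelfSimilar

section Reductions

variable {γ : ℝ → ℂ} {g : ℝ → ℝ}

/-- The value of `g` at `s` is the minimum over `[s, t]`. -/
def MinAtLeft (g : ℝ → ℝ) (s t : ℝ) : Prop := ∀ u ∈ Set.Icc s t, g s ≤ g u

/-- Every point of the unit interval lies in one of its four quarters. -/
theorem exists_quarter {t : ℝ} (ht : t ∈ Set.Icc (0:ℝ) 1) : ∃ t' ∈ Set.Icc (0:ℝ) 1,
    t = t' / 4 ∨ t = (1 + t') / 4 ∨ t = (3 - t') / 4 ∨ t = (3 + t') / 4 := by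
  obtain ⟨h0, h1⟩ := ht
  rcases le_total t (1 / 4) with h | h
  · exact ⟨4 * t, ⟨by linarith, by linarith⟩, Or.inl (by ring)⟩
  rcases le_total t (1 / 2) with h' | h'
  · exact ⟨4 * t - 1, ⟨by linarith, by linarith⟩, Or.inr (Or.inl (by ring))⟩
  rcases le_total t (3 / 4) with h'' | h''
  · exact ⟨3 - 4 * t, ⟨by linarith, by linarith⟩, Or.inr (Or.inr (Or.inl (by ring)))⟩
  · exact ⟨4 * t - 3, ⟨by linarith, by linarith⟩, Or.inr (Or.inr (Or.inr (by ring)))⟩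

/-- Every point of the unit interval lies in one of its halves. -/
theorem exists_half {t : ℝ} (ht : t ∈ Set.Icc (0:ℝ) 1) : ∃ t' ∈ Set.Icc (0:ℝ) 1,
    t = t' / 2 ∨ t = (1 + t') / 2 := by
  obtain ⟨h0, h1⟩ := ht
  rcases le_total t (1 / 2) with h | h
  · exact ⟨2 * t, ⟨by linarith, by linarith⟩, Or.inl (by ring)⟩
  · exact ⟨2 * t - 1, ⟨by linarith, by linarith⟩, Or.inr (by ring)⟩

/-- The contour function whose trunk consists of the two legs of the triangle. -/
noncomputable def legsContour (g : ℝ → ℝ) (t : ℝ) : ℝ := (g (2 * t) + g (2 * t - 1)) / 2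

namespace IsSierpinskiCurve

variable (hγ : IsSierpinskiCurve γ)
include hγ

theorem one : γ 1 = 1 := by simpa [hγ.zero] using hγ.reverse 0

theorem second_half {t : ℝ} (ht : t ∈ Set.Icc (0:ℝ) 1) :
    γ ((1 + t) / 2) = (1 + Complex.I) / 2 + (1 - Complex.I) / 2 * (starRingEnd ℂ) (γ t) := by
  rw [show (1 + t) / 2 = 1 - (1 - t) / 2 by ring, hγ.reverse,
    hγ.half _ ⟨by linarith [ht.2], by linarith [ht.1]⟩, hγ.reverse]
  simp only [map_add, map_mul, map_sub, map_div₀, map_one, Complex.conj_I, map_ofNat,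
    Complex.conj_conj]
  ring

theorem fst {t : ℝ} (ht : t ∈ Set.Icc (0:ℝ) 1) : γ (t / 4) = γ t / 2 := by
  rw [show t / 4 = t / 2 / 2 by ring, hγ.half _ ⟨by linarith [ht.1], by linarith [ht.2]⟩,
    hγ.half _ ht]
  simp only [map_add, map_mul, map_div₀, map_one, Complex.conj_I, map_ofNat, Complex.conj_conj]
  linear_combination (-γ t / 4) * Complex.I_sq

theorem snd {t : ℝ} (ht : t ∈ Set.Icc (0:ℝ) 1) :
    γ ((1 + t) / 4) = 1 / 2 + Complex.I / 2 * γ t := by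
  rw [show (1 + t) / 4 = (1 + t) / 2 / 2 by ring,
    hγ.half _ ⟨by linarith [ht.1], by linarith [ht.2]⟩, hγ.second_half ht]
  simp only [map_add, map_mul, map_sub, map_div₀, map_one, Complex.conj_I, map_ofNat,
    Complex.conj_conj]
  linear_combination ((γ t - 1) / 4) * Complex.I_sq

theorem trd {t : ℝ} (ht : t ∈ Set.Icc (0:ℝ) 1) :
    γ ((3 - t) / 4) = 1 / 2 + Complex.I / 2 * (starRingEnd ℂ) (γ t) := by
  rw [show (3 - t) / 4 = 1 - (1 + t) / 4 by ring, hγ.reverse, hγ.snd ht]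
  simp only [map_add, map_mul, map_div₀, map_one, Complex.conj_I, map_ofNat]
  ring

theorem fth {t : ℝ} (ht : t ∈ Set.Icc (0:ℝ) 1) : γ ((3 + t) / 4) = 1 / 2 + γ t / 2 := by
  rw [show (3 + t) / 4 = 1 - (1 - t) / 4 by ring, hγ.reverse,
    hγ.fst ⟨by linarith [ht.2], by linarith [ht.1]⟩, hγ.reverse]
  simp only [map_sub, map_div₀, map_one, map_ofNat, Complex.conj_conj]
  ring

end IsSierpinskiCurve

namespace IsHypotenuseContour

variable (hg : IsHypotenuseContour g)
include hg

theorem nonneg {t : ℝ} (ht : t ∈ Set.Icc (0:ℝ) 1) : 0 ≤ g t := by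
  obtain ⟨m, hm, hmin⟩ := isCompact_Icc.exists_isMinOn (Set.nonempty_Icc.2 zero_le_one)
    hg.continuous.continuousOn
  refine le_trans ?_ (hmin ht)
  obtain ⟨m', hm', h⟩ := exists_quarter hm
  have h' : g m ≤ g m' := hmin hm'
  rcases h with rfl | rfl | rfl | rfl
  · rw [hg.fst _ hm'] at *; linarith
  · rw [hg.snd _ hm'] at *; linarith
  · rw [hg.trd _ hm'] at *; linarith
  · rw [hg.fth _ hm'] at *; linarith

theorem le_one {t : ℝ} (ht : t ∈ Set.Icc (0:ℝ) 1) : g t ≤ 1 := by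
  obtain ⟨m, hm, hmax⟩ := isCompact_Icc.exists_isMaxOn (Set.nonempty_Icc.2 zero_le_one)
    hg.continuous.continuousOn
  refine le_trans (hmax ht) ?_
  obtain ⟨m', hm', h⟩ := exists_quarter hm
  have h' : g m' ≤ g m := hmax hm'
  rcases h with rfl | rfl | rfl | rfl
  · rw [hg.fst _ hm'] at *; linarith
  · rw [hg.snd _ hm'] at *; linarith
  · rw [hg.trd _ hm'] at *; linarith
  · rw [hg.fth _ hm'] at *; linarith

theorem three_quarters : g (3 / 4) = 1 / 2 := by
  simpa [hg.left 0 le_rfl] using hg.trd 0 ⟨le_rfl, zero_le_one⟩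

theorem eq_zero_of_apply_eq_zero {t : ℝ} (ht : t ∈ Set.Icc (0:ℝ) 1) (h : g t = 0) : t = 0 := by
  obtain ⟨m, ⟨hm, hm0⟩, hmax⟩ := (isCompact_Icc.inter_right
    (isClosed_singleton.preimage hg.continuous)).exists_isGreatest
    (s := Set.Icc (0:ℝ) 1 ∩ g ⁻¹' {0}) ⟨t, ht, h⟩
  refine le_antisymm ((hmax ⟨ht, h⟩).trans ?_) ht.1
  obtain ⟨m', hm', h'⟩ := exists_quarter hm
  have hm'0 := hg.nonneg hm'
  rw [Set.mem_preimage, Set.mem_singleton_iff] at hm0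
  rcases h' with rfl | rfl | rfl | rfl
  · rw [hg.fst _ hm'] at hm0
    have := hmax ⟨hm', show g m' = 0 by linarith⟩
    linarith
  · rw [hg.snd _ hm'] at hm0; linarith
  · rw [hg.trd _ hm'] at hm0; linarith
  · rw [hg.fth _ hm'] at hm0; linarith

theorem minAtLeft_fst {s t : ℝ} (hs : s ∈ Set.Icc (0:ℝ) 1) (ht : t ∈ Set.Icc (0:ℝ) 1) {b : ℝ}
    (hb : t / 4 ≤ b) (h : MinAtLeft g (s / 4) b) : MinAtLeft g s t := fun u hu => by
  have := h (u / 4) ⟨by linarith [hu.1], by linarith [hu.2]⟩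
  rw [hg.fst _ hs, hg.fst _ ⟨hs.1.trans hu.1, hu.2.trans ht.2⟩] at this
  linarith

theorem minAtLeft_snd {s t : ℝ} (hs : s ∈ Set.Icc (0:ℝ) 1) (ht : t ∈ Set.Icc (0:ℝ) 1) {b : ℝ}
    (hb : (1 + t) / 4 ≤ b) (h : MinAtLeft g ((1 + s) / 4) b) : MinAtLeft g s t := fun u hu => by
  have := h ((1 + u) / 4) ⟨by linarith [hu.1], by linarith [hu.2]⟩
  rw [hg.snd _ hs, hg.snd _ ⟨hs.1.trans hu.1, hu.2.trans ht.2⟩] at this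
  linarith

theorem minAtLeft_trd {s t a : ℝ} (hs : s ∈ Set.Icc (0:ℝ) 1) (ht : t ∈ Set.Icc (0:ℝ) 1)
    (ha : a ≤ (3 - t) / 4) (heq : g a = g ((3 - s) / 4)) (h : MinAtLeft g a ((3 - s) / 4)) :
    MinAtLeft g s t := fun u hu => by
  have := h ((3 - u) / 4) ⟨by linarith [hu.2], by linarith [hu.1]⟩
  rw [heq, hg.trd _ hs, hg.trd _ ⟨hs.1.trans hu.1, hu.2.trans ht.2⟩] at this
  linarith

theorem minAtLeft_fth {s t : ℝ} (hs : s ∈ Set.Icc (0:ℝ) 1) (ht : t ∈ Set.Icc (0:ℝ) 1) {b : ℝ}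
    (hb : (3 + t) / 4 ≤ b) (h : MinAtLeft g ((3 + s) / 4) b) : MinAtLeft g s t := fun u hu => by
  have := h ((3 + u) / 4) ⟨by linarith [hu.1], by linarith [hu.2]⟩
  rw [hg.fth _ hs, hg.fth _ ⟨hs.1.trans hu.1, hu.2.trans ht.2⟩] at this
  linarith

/-- A point of the second or third quarter whose height persists up to `3 / 4` has height at most
that of the corner `1 / 2`. -/
theorem eq_zero_of_minAtLeft {s' a b : ℝ} (hs : s' ∈ Set.Icc (0:ℝ) 1)
    (ha : g a = 1 / 2 + g s' / 2) (ha' : a ≤ 3 / 4) (hb : 3 / 4 ≤ b) (h : MinAtLeft g a b) :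
    s' = 0 := by
  have h1 := h (3 / 4) ⟨ha', hb⟩
  rw [hg.three_quarters, ha] at h1
  exact hg.eq_zero_of_apply_eq_zero hs (by linarith [hg.nonneg hs])

/-- On the trunk the curve runs along the hypotenuse. -/
theorem curve_eq_of_minAtLeft_one (hγ : IsSierpinskiCurve γ) {t : ℝ}
    (ht : t ∈ Set.Icc (0:ℝ) 1) (h : MinAtLeft g t 1) : γ t = g t := by
  obtain ⟨C, hC⟩ := (isCompact_Icc (a := (0:ℝ)) (b := 1)).exists_bound_of_continuousOn
    (f := fun t => γ t - g t)
    (hγ.continuous.sub (Complex.continuous_ofReal.comp hg.continuous)).continuousOn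
  have hC0 : 0 ≤ C := (norm_nonneg _).trans (hC t ht)
  have key : ∀ n : ℕ, ∀ t ∈ Set.Icc (0:ℝ) 1, MinAtLeft g t 1 → ‖γ t - g t‖ ≤ C * (1 / 2) ^ n := by
    intro n
    induction n with
    | zero => exact fun t ht _ => by simpa using hC t ht
    | succ n ih =>
      intro t ht h
      have hpos : 0 ≤ C * (1 / 2 : ℝ) ^ (n + 1) := by positivity
      obtain ⟨t', ht', rfl | rfl | rfl | rfl⟩ := exists_quarter ht
      · have := ih t' ht' (hg.minAtLeft_fst ht' ⟨zero_le_one, le_rfl⟩ (by norm_num) h)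
        rw [hγ.fst ht', hg.fst _ ht', Complex.ofReal_div, Complex.ofReal_ofNat, ← sub_div, norm_div,
          Complex.norm_ofNat, pow_succ]
        linarith
      · obtain rfl := hg.eq_zero_of_minAtLeft ht' (hg.snd _ ht') (by linarith [ht'.2])
          (by norm_num) h
        rw [hγ.snd ht', hg.snd _ ht', hγ.zero, hg.left 0 le_rfl]
        simpa using hpos
      · obtain rfl := hg.eq_zero_of_minAtLeft ht' (hg.trd _ ht') (by linarith [ht'.1])
          (by norm_num) h
        rw [hγ.trd ht', hg.trd _ ht', hγ.zero, hg.left 0 le_rfl]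
        simpa using hpos
      · have := ih t' ht' (hg.minAtLeft_fth ht' ⟨zero_le_one, le_rfl⟩ (by norm_num) h)
        rw [hγ.fth ht', hg.fth _ ht', show (1 / 2 + γ t' / 2 - ((1 / 2 + g t' / 2 : ℝ) : ℂ)) =
          (γ t' - g t') / 2 by push_cast; ring, norm_div, Complex.norm_ofNat, pow_succ]
        linarith
  rw [← sub_eq_zero, ← norm_le_zero_iff]
  refine ge_of_tendsto' (x := atTop) (f := fun n : ℕ => C * (1 / 2 : ℝ) ^ n) ?_
    fun n => key n t ht h
  simpa using (tendsto_pow_atTop_nhds_zero_of_lt_one (by norm_num : (0:ℝ) ≤ 1 / 2)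
    (by norm_num)).const_mul C

/-- The contour function identifies only parameters with the same image on the curve. -/
theorem curve_eq_of_minAtLeft (hγ : IsSierpinskiCurve γ) {s t : ℝ} (hs : s ∈ Set.Icc (0:ℝ) 1)
    (ht : t ∈ Set.Icc (0:ℝ) 1) (hst : s ≤ t) (heq : g s = g t) (h : MinAtLeft g s t) :
    γ s = γ t := by
  obtain ⟨C, hC⟩ := (isCompact_Icc (a := (0:ℝ)) (b := 1)).exists_bound_of_continuousOn
    hγ.continuous.continuousOn
  have hC0 : 0 ≤ C := (norm_nonneg _).trans (hC t ht)
  have key : ∀ n : ℕ, ∀ s ∈ Set.Icc (0:ℝ) 1, ∀ t ∈ Set.Icc (0:ℝ) 1, s ≤ t → g s = g t →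
      MinAtLeft g s t → ‖γ s - γ t‖ ≤ 2 * C * (1 / 2) ^ n := by
    intro n
    induction n with
    | zero =>
      intro s hs t ht _ _ _
      have := norm_sub_le (γ s) (γ t)
      have := hC s hs
      have := hC t ht
      simp only [pow_zero, mul_one]
      linarith
    | succ n ih =>
      intro s hs t ht hst heq h
      have hpos : 0 ≤ 2 * C * (1 / 2 : ℝ) ^ (n + 1) := by positivity
      have of_eq : γ s = γ t → ‖γ s - γ t‖ ≤ 2 * C * (1 / 2 : ℝ) ^ (n + 1) := fun h => by
        rwa [h, sub_self, norm_zero]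
      have h1 : (1:ℝ) ∈ Set.Icc (0:ℝ) 1 := ⟨zero_le_one, le_rfl⟩
      obtain ⟨s', hs', hsq⟩ := exists_quarter hs
      obtain ⟨t', ht', htq⟩ := exists_quarter ht
      have first : s = s' / 4 → g t = 1 / 2 + g t' / 2 → 1 / 4 ≤ t →
          γ s = 1 / 2 ∧ t' = 0 := by
        rintro rfl hgt hq
        rw [hg.fst _ hs', hgt] at heq
        have b1 := hg.le_one hs'
        have b2 := hg.nonneg ht'
        refine ⟨?_, hg.eq_zero_of_apply_eq_zero ht' (by linarith)⟩
        rw [hγ.fst hs', hg.curve_eq_of_minAtLeft_one hγ hs'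
          (hg.minAtLeft_fst hs' h1 hq h), show g s' = 1 by linarith]
        simp
      have last : s ≤ 3 / 4 → g s = 1 / 2 + g s' / 2 → t = (3 + t') / 4 → s' = 0 ∧ t' = 0 := by
        rintro hle hgs rfl
        obtain rfl := hg.eq_zero_of_minAtLeft hs' hgs hle (by linarith [ht'.1]) h
        rw [hgs, hg.fth _ ht', hg.left 0 le_rfl] at heq
        exact ⟨rfl, hg.eq_zero_of_apply_eq_zero ht' (by linarith)⟩
      have swap : t ≤ s → ‖γ s - γ t‖ ≤ 2 * C * (1 / 2 : ℝ) ^ (n + 1) := fun hts =>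
        of_eq (by rw [le_antisymm hst hts])
      have ⟨hs0, hs1⟩ := hs'
      have ⟨ht0, ht1⟩ := ht'
      rcases hsq with rfl | rfl | rfl | rfl
      · rcases htq with rfl | rfl | rfl | rfl
        · rw [hg.fst _ hs', hg.fst _ ht'] at heq
          have := ih s' hs' t' ht' (by linarith) (by linarith)
            (hg.minAtLeft_fst hs' ht' le_rfl h)
          rw [hγ.fst hs', hγ.fst ht', ← sub_div, norm_div, Complex.norm_ofNat, pow_succ]
          linarith
        · obtain ⟨e, rfl⟩ := first rfl (hg.snd _ ht') (by linarith)
          exact of_eq (by rw [e, hγ.snd ht', hγ.zero]; simp)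
        · obtain ⟨e, rfl⟩ := first rfl (hg.trd _ ht') (by linarith)
          exact of_eq (by rw [e, hγ.trd ht', hγ.zero]; simp)
        · obtain ⟨e, rfl⟩ := first rfl (hg.fth _ ht') (by linarith)
          exact of_eq (by rw [e, hγ.fth ht', hγ.zero]; simp)
      · rcases htq with rfl | rfl | rfl | rfl
        · exact swap (by linarith)
        · rw [hg.snd _ hs', hg.snd _ ht'] at heq
          have := ih s' hs' t' ht' (by linarith) (by linarith)
            (hg.minAtLeft_snd hs' ht' le_rfl h)
          rw [hγ.snd hs', hγ.snd ht', add_sub_add_left_eq_sub, ← mul_sub, norm_mul, norm_div,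
            Complex.norm_I, Complex.norm_ofNat, pow_succ]
          linarith
        · have htrunk := hg.minAtLeft_snd hs' h1 (by linarith) h
          have htrunk' := hg.minAtLeft_trd ht' h1 (by linarith) heq h
          rw [hg.snd _ hs', hg.trd _ ht'] at heq
          refine of_eq ?_
          rw [hγ.snd hs', hγ.trd ht', hg.curve_eq_of_minAtLeft_one hγ hs' htrunk,
            hg.curve_eq_of_minAtLeft_one hγ ht' htrunk', Complex.conj_ofReal,
            show g s' = g t' by linarith]
        · obtain ⟨rfl, rfl⟩ := last (by linarith) (hg.snd _ hs') rfl
          exact of_eq (by rw [hγ.snd hs', hγ.fth ht', hγ.zero]; simp)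
      · rcases htq with rfl | rfl | rfl | rfl
        · exact swap (by linarith)
        · exact swap (by linarith)
        · have htrunk := hg.minAtLeft_trd ht' hs' (by linarith) heq h
          rw [hg.trd _ hs', hg.trd _ ht'] at heq
          have := ih t' ht' s' hs' (by linarith) (by linarith) htrunk
          rw [hγ.trd hs', hγ.trd ht', add_sub_add_left_eq_sub, ← mul_sub, ← map_sub, norm_mul,
            norm_div, RCLike.norm_conj, Complex.norm_I, Complex.norm_ofNat, pow_succ, norm_sub_rev]
          linarith
        · obtain ⟨rfl, rfl⟩ := last (by linarith) (hg.trd _ hs') rfl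
          exact of_eq (by rw [hγ.trd hs', hγ.fth ht', hγ.zero]; simp)
      · rcases htq with rfl | rfl | rfl | rfl
        · exact swap (by linarith)
        · exact swap (by linarith)
        · exact swap (by linarith)
        · rw [hg.fth _ hs', hg.fth _ ht'] at heq
          have := ih s' hs' t' ht' (by linarith) (by linarith)
            (hg.minAtLeft_fth hs' ht' le_rfl h)
          rw [hγ.fth hs', hγ.fth ht', add_sub_add_left_eq_sub, ← sub_div, norm_div,
            Complex.norm_ofNat, pow_succ]
          linarith
  rw [← sub_eq_zero, ← norm_le_zero_iff]
  refine ge_of_tendsto' (x := atTop) (f := fun n : ℕ => 2 * C * (1 / 2 : ℝ) ^ n) ?_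
    fun n => key n s hs t ht hst heq h
  simpa using (tendsto_pow_atTop_nhds_zero_of_lt_one (by norm_num : (0:ℝ) ≤ 1 / 2)
    (by norm_num)).const_mul (2 * C)

theorem legsContour_half {t : ℝ} (ht : t ∈ Set.Icc (0:ℝ) 1) : legsContour g (t / 2) = g t / 2 := by
  rw [legsContour, hg.left (2 * (t / 2) - 1) (by linarith [ht.2]), mul_div_cancel₀ t two_ne_zero,
    add_zero]

theorem legsContour_second_half {t : ℝ} (ht : t ∈ Set.Icc (0:ℝ) 1) :
    legsContour g ((1 + t) / 2) = 1 / 2 + g t / 2 := by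
  rw [legsContour, hg.right (2 * ((1 + t) / 2)) (by linarith [ht.1]),
    show 2 * ((1 + t) / 2) - 1 = t by ring, add_div]

theorem legsContour_nonneg {t : ℝ} (ht : t ∈ Set.Icc (0:ℝ) 1) : 0 ≤ legsContour g t := by
  obtain ⟨t', ht', rfl | rfl⟩ := exists_half ht
  · rw [hg.legsContour_half ht']; linarith [hg.nonneg ht']
  · rw [hg.legsContour_second_half ht']; linarith [hg.nonneg ht']

/-- On the trunk of the legs contour the curve runs along the legs of the triangle. -/
theorem curve_eq_of_legs_minAtLeft_one (hγ : IsSierpinskiCurve γ) {t : ℝ}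
    (ht : t ∈ Set.Icc (0:ℝ) 1) (h : MinAtLeft (legsContour g) t 1) :
    γ t = legsContour g t + min (legsContour g t) (1 - legsContour g t) * Complex.I := by
  obtain ⟨t', ht', rfl | rfl⟩ := exists_half ht
  · have htrunk : MinAtLeft g t' 1 := fun u hu => by
      have hu' : u ∈ Set.Icc (0:ℝ) 1 := ⟨ht'.1.trans hu.1, hu.2⟩
      have := h (u / 2) ⟨by linarith [hu.1], by linarith [hu.2]⟩
      rw [hg.legsContour_half ht', hg.legsContour_half hu'] at this
      linarith
    rw [hγ.half _ ht', hg.curve_eq_of_minAtLeft_one hγ ht' htrunk, hg.legsContour_half ht',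
      min_eq_left (by linarith [hg.le_one ht']), Complex.conj_ofReal]
    push_cast
    ring
  · have htrunk : MinAtLeft g t' 1 := fun u hu => by
      have hu' : u ∈ Set.Icc (0:ℝ) 1 := ⟨ht'.1.trans hu.1, hu.2⟩
      have := h ((1 + u) / 2) ⟨by linarith [hu.1], by linarith [hu.2]⟩
      rw [hg.legsContour_second_half ht', hg.legsContour_second_half hu'] at this
      linarith
    rw [hγ.second_half ht', hg.curve_eq_of_minAtLeft_one hγ ht' htrunk,
      hg.legsContour_second_half ht', min_eq_right (by linarith [hg.nonneg ht']),
      Complex.conj_ofReal]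
    push_cast
    ring

theorem curve_eq_of_legs_minAtLeft (hγ : IsSierpinskiCurve γ) {s t : ℝ}
    (hs : s ∈ Set.Icc (0:ℝ) 1) (ht : t ∈ Set.Icc (0:ℝ) 1) (hst : s ≤ t)
    (heq : legsContour g s = legsContour g t) (h : MinAtLeft (legsContour g) s t) :
    γ s = γ t := by
  obtain ⟨s', hs', rfl | rfl⟩ := exists_half hs <;> obtain ⟨t', ht', rfl | rfl⟩ := exists_half ht
  · rw [hg.legsContour_half hs', hg.legsContour_half ht'] at heq
    rw [hγ.half _ hs', hγ.half _ ht', hg.curve_eq_of_minAtLeft hγ hs' ht' (by linarith)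
      (by linarith) fun u hu => ?_]
    have := h (u / 2) ⟨by linarith [hu.1], by linarith [hu.2]⟩
    rw [hg.legsContour_half hs', hg.legsContour_half ⟨hs'.1.trans hu.1, hu.2.trans ht'.2⟩] at this
    linarith
  · rw [hg.legsContour_half hs', hg.legsContour_second_half ht'] at heq
    have b1 := hg.le_one hs'
    have b2 := hg.nonneg ht'
    obtain rfl := hg.eq_zero_of_apply_eq_zero ht' (by linarith)
    have htrunk : MinAtLeft g s' 1 := fun u hu => by
      have hu' : u ∈ Set.Icc (0:ℝ) 1 := ⟨hs'.1.trans hu.1, hu.2⟩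
      have := h (u / 2) ⟨by linarith [hu.1], by linarith [hu.2]⟩
      rw [hg.legsContour_half hs', hg.legsContour_half hu'] at this
      linarith
    rw [hγ.half _ hs', hγ.second_half ht', hg.curve_eq_of_minAtLeft_one hγ hs' htrunk, hγ.zero,
      show g s' = 1 by linarith]
    simp
  · rw [le_antisymm hst (by linarith [hs'.1, ht'.2])]
  · rw [hg.legsContour_second_half hs', hg.legsContour_second_half ht'] at heq
    rw [hγ.second_half hs', hγ.second_half ht', hg.curve_eq_of_minAtLeft hγ hs' ht' (by linarith)
      (by linarith) fun u hu => ?_]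
    have := h ((1 + u) / 2) ⟨by linarith [hu.1], by linarith [hu.2]⟩
    rw [hg.legsContour_second_half hs',
      hg.legsContour_second_half ⟨hs'.1.trans hu.1, hu.2.trans ht'.2⟩] at this
    linarith

end IsHypotenuseContour

end Reductions

section Homotopy

variable {X : Type*} [TopologicalSpace X]

/-- A map from the square that is constant on the two sides `x = 0` and `x = 1` stays continuous
when its other argument is replaced by a function continuous away from these sides. -/
theorem continuous_comp_of_const_on_sides {Z : Type*} [TopologicalSpace Z]
    {H : unitInterval × unitInterval → X} (hH : Continuous H) {x y : X}
    (h0 : ∀ s, H (s, 0) = x) (h1 : ∀ s, H (s, 1) = y) {σ τ : Z → unitInterval}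
    (hτ : Continuous τ) (hσ : ∀ z, τ z ≠ 0 → τ z ≠ 1 → ContinuousAt σ z) :
    Continuous fun z => H (σ z, τ z) := by
  have side : ∀ (c : unitInterval) (w : X), (∀ s, H (s, c) = w) → ∀ z, τ z = c →
      ContinuousAt (fun z => H (σ z, τ z)) z := by
    intro c w hc z hz U hU
    rw [Filter.mem_map]
    have hU' : ∀ s : unitInterval, ∀ᶠ p in 𝓝 (z, s), H (p.2, τ p.1) ∈ U := fun s => by
      have hcont : Continuous fun p : Z × unitInterval => H (p.2, τ p.1) := by fun_prop
      refine hcont.continuousAt.eventually_mem ?_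
      have hst : H (s, τ z) = H (σ z, τ z) := by rw [hz, hc, hc]
      exact hst ▸ hU
    have := isCompact_univ.eventually_forall_of_forall_eventually
      (P := fun z s => H (s, τ z) ∈ U) (x₀ := z) fun s _ => hU' s
    filter_upwards [this] with z' hz'
    exact hz' _ (Set.mem_univ _)
  rw [continuous_iff_continuousAt]
  intro z
  by_cases hz0 : τ z = 0
  · exact side 0 x h0 z hz0
  by_cases hz1 : τ z = 1
  · exact side 1 y h1 z hz1
  exact hH.continuousAt.comp ((hσ z hz0 hz1).prodMk hτ.continuousAt)

/-- Path-homotopic paths are the images of the hypotenuse and of the legs of a triangle under a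
continuous map of the plane. -/
theorem exists_continuous_triangle {α β : C(unitInterval, X)} (h : α.HomotopicRel β {0, 1}) :
    ∃ F : ℂ → X, Continuous F ∧ (∀ t : unitInterval, F (t : ℝ) = α t) ∧
      ∀ t : unitInterval, F ((t : ℝ) + (min (t : ℝ) (1 - t) : ℝ) * Complex.I) = β t := by
  obtain ⟨H⟩ := h
  have hc0 : ∀ s, H (s, 0) = α 0 := fun s => H.eq_fst s (by simp)
  have hc1 : ∀ s, H (s, 1) = α 1 := fun s => H.eq_fst s (by simp)
  have hb0 : ∀ s, H (s, 0) = β 0 := fun s => H.eq_snd s (by simp)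
  have hb1 : ∀ s, H (s, 1) = β 1 := fun s => H.eq_snd s (by simp)
  let σ : ℂ → unitInterval := fun z => Set.projIcc 0 1 zero_le_one (z.im / min z.re (1 - z.re))
  let τ : ℂ → unitInterval := fun z => Set.projIcc 0 1 zero_le_one z.re
  have hτ : Continuous τ := continuous_projIcc.comp Complex.continuous_re
  refine ⟨fun z => H (σ z, τ z), ?_, fun t => ?_, fun t => ?_⟩
  · refine continuous_comp_of_const_on_sides H.continuous hc0 hc1 hτ fun z hz0 hz1 => ?_
    have h0 : 0 < z.re := by
      by_contra! h
      exact hz0 (Set.projIcc_of_le_left _ h)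
    have h1 : z.re < 1 := by
      by_contra! h
      exact hz1 (Set.projIcc_of_right_le _ h)
    refine continuous_projIcc.continuousAt.comp (ContinuousAt.div₀ (by fun_prop) (by fun_prop) ?_)
    exact (lt_min h0 (sub_pos.2 h1)).ne'
  · have hσt : σ (t : ℝ) = 0 := by simp [σ]
    have hτt : τ (t : ℝ) = t := by simp [τ]
    simp only [hσt, hτt, H.apply_zero]
  · set z : ℂ := (t : ℝ) + (min (t : ℝ) (1 - t) : ℝ) * Complex.I with hz
    have hre : z.re = t := by simp [hz]
    have him : z.im = min (t : ℝ) (1 - t) := by simp [hz]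
    have hτt : τ z = t := by simp [τ, hre]
    simp only [hτt]
    by_cases ht0 : t = 0
    · rw [ht0, hb0]
    by_cases ht1 : t = 1
    · rw [ht1, hb1]
    have hpos : 0 < min (t : ℝ) (1 - t) :=
      lt_min (unitInterval.pos_iff_ne_zero.2 ht0) (sub_pos.2 (unitInterval.lt_one_iff_ne_one.2 ht1))
    have hσt : σ z = 1 := by simp [σ, hre, him, div_self hpos.ne']
    rw [hσt, H.apply_one]

end Homotopy

/-- **Main Theorem.** Homotopic (rel endpoints) paths in a Hausdorff space are both geodesic
ℝ-tree reductions of a single common path. -/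
theorem homotopic_paths_common_reduction {X : Type*} [TopologicalSpace X] [T2Space X]
    (α β : unitInterval → X) (hα : Continuous α) (hβ : Continuous β)
    (h : (ContinuousMap.mk α hα).HomotopicRel (ContinuousMap.mk β hβ) {0, 1}) :
    ∃ γ : unitInterval → X, Continuous γ ∧ GeodesicReduction γ α ∧ GeodesicReduction γ β := by
  obtain ⟨F, hF, hFα, hFβ⟩ := exists_continuous_triangle h
  obtain ⟨γ, hγ⟩ := exists_isSierpinskiCurve
  obtain ⟨g, hg⟩ := exists_isHypotenuseContour
  have hgc := hg.continuous
  have hγF : Continuous fun t : unitInterval => F (γ t) :=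
    hF.comp (hγ.continuous.comp continuous_subtype_val)
  refine ⟨fun t => F (γ t), hγF, ?_, ?_⟩
  · refine geodesicReduction_of_contour ⟨g, hgc⟩ (fun t ht => hg.nonneg ht) (hg.left 0 le_rfl)
      (hg.right 1 le_rfl) hγF (fun s t hst heq hmin => ?_) fun s h hs hmin => ?_
    · exact congrArg F (hg.curve_eq_of_minAtLeft hγ s.2 t.2 hst heq hmin)
    · change g s = h at hs
      rw [hg.curve_eq_of_minAtLeft_one hγ s.2 hmin, hs]
      exact hFα h
  · have hlc : Continuous (legsContour g) := by unfold legsContour; fun_prop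
    refine geodesicReduction_of_contour ⟨legsContour g, hlc⟩ (fun t ht => hg.legsContour_nonneg ht)
      ?_ ?_ hγF (fun s t hst heq hmin => ?_) fun s h hs hmin => ?_
    · simp [legsContour, hg.left]
    · norm_num [legsContour, hg.right]
    · exact congrArg F (hg.curve_eq_of_legs_minAtLeft hγ s.2 t.2 hst heq hmin)
    · change legsContour g s = h at hs
      rw [hg.curve_eq_of_legs_minAtLeft_one hγ s.2 hmin, hs]
      exact hFβ h
end

section
/- Let X be a Hausdorff topological space. The relation ≥ᵣ on paths in X is antisymmetric up to equivalence: if α, β : [0,1] → X are paths with α ≥ᵣ β and β ≥ᵣ α, then α ≡ β. -/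
open Set Filter Topology

/-- `x` and `y` are joined inside `U` by a possibly degenerate arc. -/
def ArcJoinedIn {T : Type*} [TopologicalSpace T] (U : Set T) (x y : T) : Prop :=
  ∃ (a b : ℝ) (γ : ℝ → T), a ≤ b ∧ ContinuousOn γ (Icc a b) ∧ InjOn γ (Icc a b) ∧
    MapsTo γ (Icc a b) U ∧ γ a = x ∧ γ b = y

theorem ArcJoinedIn.symm {T : Type*} [TopologicalSpace T] {U : Set T} {x y : T}
    (h : ArcJoinedIn U x y) : ArcJoinedIn U y x := by
  obtain ⟨a, b, γ, hab, hc, hi, hm, rfl, rfl⟩ := h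
  have hmaps : MapsTo (fun t : ℝ => -t) (Icc (-b) (-a)) (Icc a b) :=
    fun t ht => ⟨by linarith [ht.2], by linarith [ht.1]⟩
  exact ⟨-b, -a, fun t => γ (-t), by linarith, hc.comp continuous_neg.continuousOn hmaps,
    hi.comp neg_injective.injOn hmaps, hm.comp hmaps, by simp, by simp⟩

theorem ArcJoinedIn.trans {T : Type*} [TopologicalSpace T] [T2Space T] {U : Set T} {x y z : T}
    (h₁ : ArcJoinedIn U x y) (h₂ : ArcJoinedIn U y z) : ArcJoinedIn U x z := by
  obtain ⟨a, b, p, hab, hpc, hpi, hpm, rfl, rfl⟩ := h₁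
  obtain ⟨c, d, q, hcd, hqc, hqi, hqm, hqp, rfl⟩ := h₂
  have hclosed : IsClosed (q '' Icc c d) := (isCompact_Icc.image_of_continuousOn hqc).isClosed
  have hS : IsCompact (Icc a b ∩ p ⁻¹' (q '' Icc c d)) :=
    isCompact_Icc.of_isClosed_subset
      (hpc.preimage_isClosed_of_isClosed isClosed_Icc hclosed) inter_subset_left
  obtain ⟨τ, ⟨hτ, σ, hσ, hστ⟩, hmin⟩ :=
    hS.exists_isLeast ⟨b, right_mem_Icc.2 hab, c, left_mem_Icc.2 hcd, hqp⟩
  have hne : ∀ s ∈ Icc a τ, ∀ t ∈ Icc σ d, p s = q t → s = τ := fun s hs t ht hst =>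
    le_antisymm hs.2
      (hmin ⟨⟨hs.1, hs.2.trans hτ.2⟩, t, ⟨hσ.1.trans ht.1, ht.2⟩, hst.symm⟩)
  have hright : ∀ t : ℝ, ¬ t ≤ τ → t ≤ τ + (d - σ) → t - τ + σ ∈ Icc σ d :=
    fun t h₁ h₂ => ⟨by linarith, by linarith⟩
  have hrc : ∀ t ∈ Icc σ d, t ∈ Icc c d := fun t ht => ⟨hσ.1.trans ht.1, ht.2⟩
  have hlc : ∀ t ∈ Icc a τ, t ∈ Icc a b := fun t ht => ⟨ht.1, ht.2.trans hτ.2⟩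
  refine ⟨a, τ + (d - σ), fun t => if t ≤ τ then p t else q (t - τ + σ), ?_, ?_, ?_, ?_, ?_, ?_⟩
  · linarith [hτ.1, hσ.2]
  · refine ContinuousOn.if ?_ ?_ ?_
    · rintro t ⟨-, ht⟩
      have : t = τ := frontier_le_subset_eq continuous_id continuous_const ht
      simp [this, hστ]
    · refine hpc.mono fun t ht => hlc t ⟨ht.1.1, ?_⟩
      exact (isClosed_Iic (a := τ)).closure_subset ht.2
    · refine hqc.comp (by fun_prop) fun t ht => ?_
      have hle : τ ≤ t := (isClosed_Ici (a := τ)).closure_subset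
        (closure_mono (fun s hs => (not_le.1 hs).le) ht.2)
      exact ⟨by linarith [hσ.1], by linarith [ht.1.2]⟩
  · intro s hs t ht hst
    dsimp only at hst
    split_ifs at hst with h₁ h₂ h₂
    · exact hpi (hlc s ⟨hs.1, h₁⟩) (hlc t ⟨ht.1, h₂⟩) hst
    · have h := hright t h₂ ht.2
      have hsτ := hne s ⟨hs.1, h₁⟩ _ h hst
      rw [hsτ, ← hστ] at hst
      have := hqi hσ (hrc _ h) hst
      linarith
    · have h := hright s h₁ hs.2
      have htτ := hne t ⟨ht.1, h₂⟩ _ h hst.symm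
      rw [htτ, ← hστ] at hst
      have := hqi (hrc _ h) hσ hst
      linarith
    · have := hqi (hrc _ (hright s h₁ hs.2)) (hrc _ (hright t h₂ ht.2)) hst
      linarith
  · intro t ht
    dsimp only
    split_ifs with h
    · exact hpm (hlc t ⟨ht.1, h⟩)
    · exact hqm (hrc _ (hright t h ht.2))
  · exact if_pos hτ.1
  · dsimp only
    split_ifs with h
    · have : σ = d := by linarith [hσ.2]
      rw [← this, hστ]
      congr 1
      linarith
    · congr 1
      ring

/-- In a Hausdorff space, the endpoints of a non-degenerate arc are joined by an injective path
parametrised by the unit interval. -/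
theorem ArcJoinedIn.exists_injective {T : Type*} [TopologicalSpace T] {U : Set T} {x y : T}
    (h : ArcJoinedIn U x y) (hxy : x ≠ y) :
    ∃ q : unitInterval → T, Continuous q ∧ Function.Injective q ∧ range q ⊆ U ∧
      q 0 = x ∧ q 1 = y := by
  obtain ⟨a, b, γ, hab, hc, hi, hm, rfl, rfl⟩ := h
  have hlt : a < b := lt_of_le_of_ne hab fun h => hxy (by rw [h])
  have hmem : ∀ t : unitInterval, a + (b - a) * (t : ℝ) ∈ Icc a b := fun t =>
    ⟨by nlinarith [t.2.1, t.2.2], by nlinarith [t.2.1, t.2.2]⟩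
  refine ⟨fun t => γ (a + (b - a) * (t : ℝ)), hc.comp_continuous (by fun_prop) hmem, ?_, ?_,
    by simp, by simp⟩
  · intro s t hst
    have := hi (hmem s) (hmem t) hst
    have h' : (b - a) * (s : ℝ) = (b - a) * (t : ℝ) := by linarith
    exact Subtype.ext (mul_left_cancel₀ (sub_pos.2 hlt).ne' h')
  · rintro _ ⟨t, rfl⟩
    exact hm (hmem t)

theorem IsRTree.arcJoinedIn_ball {T : Type} [MetricSpace T] (hT : IsRTree T) {x y : T} {ε : ℝ}
    (hy : dist x y < ε) : ArcJoinedIn (Metric.ball x ε) x y := by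
  obtain ⟨γ, h₀, h₁, hγ⟩ := hT.geodesic x y
  refine ⟨0, dist x y, γ, dist_nonneg, ?_, ?_, ?_, h₀, h₁⟩
  · refine LipschitzOnWith.continuousOn (K := 1) (LipschitzOnWith.of_dist_le_mul ?_)
    intro s hs t ht
    simp [hγ s hs t ht, Real.dist_eq]
  · intro s hs t ht hst
    have := hγ s hs t ht
    rw [hst, dist_self] at this
    linarith [abs_eq_zero.1 this.symm]
  · intro t ht
    have := hγ t ht 0 (left_mem_Icc.2 dist_nonneg)
    rw [h₀, sub_zero, abs_of_nonneg ht.1] at this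
    rw [Metric.mem_ball, this]
    exact ht.2.trans_lt hy

/-- In an ℝ-tree, a path travelling from the start of an arc to a later point of it has to visit
all points of the arc in between. -/
theorem IsRTree.exists_le_apply_eq {T : Type} [MetricSpace T] (hT : IsRTree T)
    {p r : unitInterval → T} (hp : Continuous p) (hr : Continuous r)
    (hri : Function.Injective r) (h₀ : r 0 = p 0) {s s' w : unitInterval} (hs : s < s')
    (hw : p w = r s') : ∃ v ≤ w, p v = r s := by
  by_contra! hcon
  have hjoin : ArcJoinedIn {r s}ᶜ (p 0) (p w) := by
    refine isPreconnected_Icc.induction₂ (s := Icc 0 w) (fun x y => ArcJoinedIn {r s}ᶜ (p x) (p y))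
      (fun x hx => ?_) (fun _ _ _ _ _ _ h h' => h.trans h') (fun _ _ _ _ h => h.symm)
      (left_mem_Icc.2 bot_le) (right_mem_Icc.2 bot_le)
    have hpos : 0 < dist (p x) (r s) := dist_pos.2 (hcon x hx.2)
    have hev : ∀ᶠ y in 𝓝 x, dist (p x) (p y) < dist (p x) (r s) :=
      (continuous_const.dist hp).continuousAt.eventually_lt_const (by simpa using hpos)
    filter_upwards [hev.filter_mono nhdsWithin_le_nhds] with y hy
    obtain ⟨a, b, γ, hab, hc, hi, hm, hx, hy⟩ := hT.arcJoinedIn_ball hy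
    refine ⟨a, b, γ, hab, hc, hi, fun t ht hts => ?_, hx, hy⟩
    have := hm ht
    rw [mem_singleton_iff.1 hts, Metric.mem_ball, dist_comm] at this
    exact lt_irrefl _ this
  have hs'pos : (0 : unitInterval) < s' := bot_le.trans_lt hs
  rw [hw, ← h₀] at hjoin
  obtain ⟨q, hqc, hqi, hqU, hq0, hq1⟩ := hjoin.exists_injective (hri.ne hs'pos.ne)
  have hs'pos' : (0 : ℝ) < s' := hs'pos
  have hrange := hT.uniquelyArcwise (fun t => r (s' * t)) q (by fun_prop) hqc
    (fun t t' h => by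
      have := congrArg Subtype.val (hri h)
      exact Subtype.ext (mul_left_cancel₀ hs'pos'.ne' this)) hqi
    (by simp [hq0]) (by simp [hq1])
  have hmem : r s ∈ range fun t => r (s' * t) := by
    refine ⟨⟨s / s', div_nonneg s.2.1 s'.2.1, (div_le_one hs'pos').2 hs.le⟩, ?_⟩
    refine congrArg r (Subtype.ext ?_)
    exact mul_div_cancel₀ _ hs'pos'.ne'
  rw [hrange] at hmem
  exact hqU hmem rfl

/-- A geodesic ℝ-tree reduction of `α` is obtained from `α` by restricting to a set of times. -/
theorem GeodesicReduction.exists_strictMono {X : Type*} [TopologicalSpace X]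
    {α β : unitInterval → X} (h : GeodesicReduction α β) :
    ∃ t : unitInterval → unitInterval, StrictMono t ∧ β = α ∘ t := by
  obtain ⟨T, _, hT, f, p, r, -, hp, hr, hri, h₀, h₁, rfl, rfl⟩ := h
  have hleast : ∀ s, ∃ t, IsLeast (p ⁻¹' {r s}) t := fun s => by
    refine ((isClosed_singleton.preimage hp).isCompact).exists_isLeast ?_
    rcases (le_top : s ≤ ⊤).eq_or_lt with rfl | hs
    · exact ⟨1, h₁.symm⟩
    · obtain ⟨v, -, hv⟩ := hT.exists_le_apply_eq hp hr hri h₀ hs h₁.symm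
      exact ⟨v, hv⟩
  choose t ht using hleast
  have hpt : ∀ s, p (t s) = r s := fun s => (ht s).1
  refine ⟨t, fun s s' hs => ?_, funext fun s => congrArg f (hpt s).symm⟩
  obtain ⟨v, hv, hvs⟩ := hT.exists_le_apply_eq hp hr hri h₀ hs (hpt s')
  refine lt_of_le_of_ne (((ht s).2 hvs).trans hv) fun h => hs.ne (hri ?_)
  rw [← hpt, ← hpt, h]

/-- `α` is constant between `x` and `y`. -/
def ConstBetween {I X : Type*} [Lattice I] (α : I → X) (x y : I) : Prop :=
  ∀ z ∈ uIcc x y, α z = α x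

namespace ConstBetween

theorem refl {I X : Type*} [Lattice I] (α : I → X) (x : I) : ConstBetween α x x := fun z hz => by
  rw [uIcc_self] at hz
  rw [hz]

theorem symm {I X : Type*} [Lattice I] {α : I → X} {x y : I}
    (h : ConstBetween α x y) : ConstBetween α y x := fun z hz => by
  rw [h y right_mem_uIcc, h z (uIcc_comm x y ▸ hz)]

theorem trans {I X : Type*} [LinearOrder I] {α : I → X} {x y z : I}
    (h : ConstBetween α x y) (h' : ConstBetween α y z) : ConstBetween α x z := fun w hw => by
  rcases uIcc_subset_uIcc_union_uIcc (b := y) hw with hw | hw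
  · exact h w hw
  · rw [h' w hw, h y right_mem_uIcc]

theorem of_mem {I X : Type*} [LinearOrder I] {α : I → X} {x y z : I}
    (h : ConstBetween α x y) (hz : z ∈ uIcc x y) : ConstBetween α x z := fun w hw =>
  h w (uIcc_subset_uIcc_left hz hw)

/-- If reparametrising by a monotone map does not change a continuous function, then the function
is constant between each point and its image. -/
theorem of_comp_eq {I X : Type*} [CompleteLinearOrder I] [TopologicalSpace I] [OrderTopology I]
    [TopologicalSpace X] [T2Space X] {α : I → X} (hα : Continuous α) {w : I → I}
    (hw : Monotone w) (h : α ∘ w = α) (x : I) : ConstBetween α x (w x) := by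
  have hiter : ∀ n z, α (w^[n] z) = α z := fun n z => by
    induction n with
    | zero => rfl
    | succ n ih => rw [Function.iterate_succ_apply', ← ih]; exact congrFun h _
  have hlim : ∀ y z, Tendsto (fun n => w^[n] z) atTop (𝓝 y) → α z = α y := fun y z hz =>
    tendsto_nhds_unique (tendsto_const_nhds.congr fun n => (hiter n z).symm)
      ((hα.tendsto y).comp hz)
  intro z hz
  rcases le_total x (w x) with hx | hx
  · rw [uIcc_of_le hx] at hz
    have hx' := tendsto_atTop_iSup (hw.monotone_iterate_of_le_map hx)
    have hz' := tendsto_of_tendsto_of_tendsto_of_le_of_le hx' (hx'.comp (tendsto_add_atTop_nat 1))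
      (fun n => hw.iterate n hz.1) (fun n => hw.iterate n hz.2)
    rw [hlim _ _ hx', hlim _ _ hz']
  · rw [uIcc_of_ge hx] at hz
    have hx' := tendsto_atTop_iInf (hw.antitone_iterate_of_map_le hx)
    have hz' := tendsto_of_tendsto_of_tendsto_of_le_of_le (hx'.comp (tendsto_add_atTop_nat 1)) hx'
      (fun n => hw.iterate n hz.1) (fun n => hw.iterate n hz.2)
    rw [hlim _ _ hx', hlim _ _ hz']

theorem exists_endpoints {I X : Type*} [LinearOrder I] [TopologicalSpace I] [OrderTopology I]
    [CompactSpace I] [TopologicalSpace X] [T2Space X] {α : I → X} (hα : Continuous α) (x : I) :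
    ∃ a b, ∀ y, ConstBetween α x y ↔ a ≤ y ∧ y ≤ b := by
  have hclosed : IsClosed {y | ConstBetween α x y} := by
    refine isClosed_of_closure_subset fun y hy z hz => ?_
    have hyx : α y = α x :=
      (isClosed_eq hα continuous_const).closure_subset_iff.2
        (fun y' (hy' : ConstBetween α x y') => hy' y' right_mem_uIcc) hy
    rcases mem_uIcc.1 hz with ⟨h₁, h₂⟩ | ⟨h₁, h₂⟩
    · rcases h₂.eq_or_lt with rfl | h₂
      · exact hyx
      · obtain ⟨y', hy', hc⟩ := mem_closure_iff.1 hy _ isOpen_Ioi h₂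
        exact hc z (mem_uIcc.2 (Or.inl ⟨h₁, le_of_lt hy'⟩))
    · rcases h₁.eq_or_lt with rfl | h₁
      · exact hyx
      · obtain ⟨y', hy', hc⟩ := mem_closure_iff.1 hy _ isOpen_Iio h₁
        exact hc z (mem_uIcc.2 (Or.inr ⟨le_of_lt hy', h₂⟩))
  obtain ⟨a, ha, ha'⟩ := hclosed.isCompact.exists_isLeast ⟨x, ConstBetween.refl α x⟩
  obtain ⟨b, hb, hb'⟩ := hclosed.isCompact.exists_isGreatest ⟨x, ConstBetween.refl α x⟩
  refine ⟨a, b, fun y => ⟨fun h => ⟨ha' h, hb' h⟩, fun h => ?_⟩⟩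
  rcases le_total x y with hy | hy
  · exact ConstBetween.of_mem hb (mem_uIcc.2 (Or.inl ⟨hy, h.2⟩))
  · exact ConstBetween.of_mem ha (mem_uIcc.2 (Or.inr ⟨h.1, hy⟩))

theorem endpoints_eq {I X : Type*} [LinearOrder I] {α : I → X} {a b : I → I}
    (hab : ∀ x y, ConstBetween α x y ↔ a x ≤ y ∧ y ≤ b x) {x y : I} (h : ConstBetween α x y) :
    a x = a y ∧ b x = b y := by
  have hle := fun z => (hab x z).symm.trans (Iff.trans ⟨h.symm.trans, h.trans⟩ (hab y z))
  have hx := (hab x x).1 (.refl α x)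
  have hy := (hab y y).1 (.refl α y)
  exact ⟨le_antisymm ((hle (a y)).2 ⟨le_rfl, hy.1.trans hy.2⟩).1
      ((hle (a x)).1 ⟨le_rfl, hx.1.trans hx.2⟩).1,
    le_antisymm ((hle (b x)).1 ⟨hx.1.trans hx.2, le_rfl⟩).2
      ((hle (b y)).2 ⟨hy.1.trans hy.2, le_rfl⟩).2⟩

/-- If `α = β ∘ u` and `β = α ∘ t` with `t` monotone, then `u` preserves intervals of constancy. -/
theorem map {I X : Type*} [CompleteLinearOrder I] [TopologicalSpace I] [OrderTopology I]
    [TopologicalSpace X] [T2Space X] {α β : I → X} (hα : Continuous α) {t u : I → I}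
    (ht : Monotone t) (hu : Monotone u) (hβt : β = α ∘ t) (hαu : α = β ∘ u) {x y : I}
    (h : ConstBetween α x y) : ConstBetween β (u x) (u y) := by
  intro z hz
  have hw : α ∘ (t ∘ u) = α := by rw [← Function.comp_assoc, ← hβt, ← hαu]
  have hc := of_comp_eq hα (ht.comp hu) hw
  have hxy : ConstBetween α (t (u x)) (t (u y)) := (hc x).symm.trans (h.trans (hc y))
  rw [hβt]
  exact hxy (t z) (ht.mapsTo_uIcc hz)

end ConstBetween

/-- The affine map from `[a, b]` to `[c, d]`. -/
noncomputable def affineIcc (a b c d x : ℝ) : ℝ := c + (d - c) * ((x - a) / (b - a))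

theorem affineIcc_mem {a b c d x : ℝ} (hx : x ∈ Icc a b) (hcd : c ≤ d) :
    affineIcc a b c d x ∈ Icc c d := by
  have h₀ : 0 ≤ (x - a) / (b - a) :=
    div_nonneg (by linarith [hx.1]) (by linarith [hx.1, hx.2])
  have h₁ : (x - a) / (b - a) ≤ 1 :=
    div_le_one_of_le₀ (by linarith [hx.2]) (by linarith [hx.1, hx.2])
  constructor <;> unfold affineIcc <;> nlinarith

theorem affineIcc_lt {a b c d x y : ℝ} (hab : a < b) (hcd : c < d) (hxy : x < y) :
    affineIcc a b c d x < affineIcc a b c d y := by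
  unfold affineIcc
  have := div_lt_div_of_pos_right (sub_lt_sub_right hxy a) (sub_pos.2 hab)
  nlinarith

theorem affineIcc_affineIcc {a b c d x : ℝ} (hab : a < b) (hcd : c < d) :
    affineIcc a b c d (affineIcc c d a b x) = x := by
  have := (sub_pos.2 hab).ne'
  have := (sub_pos.2 hcd).ne'
  unfold affineIcc
  field_simp
  ring

theorem pathEquiv_of_strictMono {X : Type*} [TopologicalSpace X] [T2Space X]
    {α β : unitInterval → X} (hα : Continuous α) (hβ : Continuous β)
    {t u : unitInterval → unitInterval} (ht : StrictMono t) (hu : StrictMono u)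
    (hβt : β = α ∘ t) (hαu : α = β ∘ u) : PathEquiv α β := by
  have mapu : ∀ {x y}, ConstBetween α x y → ConstBetween β (u x) (u y) := fun h =>
    h.map hα ht.monotone hu.monotone hβt hαu
  have mapt : ∀ {x y}, ConstBetween β x y → ConstBetween α (t x) (t y) := fun h =>
    h.map hβ hu.monotone ht.monotone hαu hβt
  have htu : ∀ x, ConstBetween α x (t (u x)) :=
    ConstBetween.of_comp_eq hα (ht.comp hu).monotone
      (by change (α ∘ t) ∘ u = α; rw [← hβt, ← hαu])
  have hut : ∀ x, ConstBetween β x (u (t x)) :=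
    ConstBetween.of_comp_eq hβ (hu.comp ht).monotone
      (by change (β ∘ u) ∘ t = β; rw [← hαu, ← hβt])
  choose a b hab using ConstBetween.exists_endpoints hα
  choose c d hcd using ConstBetween.exists_endpoints hβ
  have hax : ∀ x, a x ≤ x ∧ x ≤ b x := fun x => (hab x x).1 (.refl α x)
  have hcx : ∀ x, c x ≤ x ∧ x ≤ d x := fun x => (hcd x x).1 (.refl β x)
  have habeq : ∀ {x y}, ConstBetween α x y → a x = a y ∧ b x = b y := fun h =>
    h.endpoints_eq hab
  have hcdeq : ∀ {x y}, ConstBetween β x y → c x = c y ∧ d x = d y := fun h =>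
    h.endpoints_eq hcd
  have hHmem : ∀ x, affineIcc (a x) (b x) (c (u x)) (d (u x)) x ∈
      Icc (c (u x) : ℝ) (d (u x)) := fun x =>
    affineIcc_mem (hax x) ((hcx (u x)).1.trans (hcx (u x)).2)
  have hGmem : ∀ y, affineIcc (c y) (d y) (a (t y)) (b (t y)) y ∈
      Icc (a (t y) : ℝ) (b (t y)) := fun y =>
    affineIcc_mem (hcx y) ((hax (t y)).1.trans (hax (t y)).2)
  let H : unitInterval → unitInterval := fun x =>
    ⟨_, (c (u x)).2.1.trans (hHmem x).1, (hHmem x).2.trans (d (u x)).2.2⟩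
  let G : unitInterval → unitInterval := fun y =>
    ⟨_, (a (t y)).2.1.trans (hGmem y).1, (hGmem y).2.trans (b (t y)).2.2⟩
  have hH : ∀ x, ConstBetween β (u x) (H x) := fun x => (hcd _ _).2 (hHmem x)
  have hG : ∀ y, ConstBetween α (t y) (G y) := fun y => (hab _ _).2 (hGmem y)
  have hmono : StrictMono H := by
    intro x y hxy
    by_cases hC : ConstBetween α x y
    · have hC' := mapu hC
      have hablt : a x < b x := (hax x).1.trans_lt (hxy.trans_le ((hab x y).1 hC).2)
      have hcdlt : c (u x) < d (u x) :=
        (hcx _).1.trans_lt ((hu hxy).trans_le ((hcd _ _).1 hC').2)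
      change affineIcc (a x) (b x) (c (u x)) (d (u x)) x <
        affineIcc (a y) (b y) (c (u y)) (d (u y)) y
      rw [← (habeq hC).1, ← (habeq hC).2, ← (hcdeq hC').1, ← (hcdeq hC').2]
      exact affineIcc_lt hablt hcdlt hxy
    · by_contra! hle
      have h₁ := ((hcd _ _).1 (hH x)).2
      have h₂ := ((hcd _ _).1 (hH y)).1
      have hm₁ : ConstBetween β (u x) (max (u x) (c (u y))) :=
        (hcd _ _).2 ⟨(hcx _).1.trans (le_max_left _ _),
          max_le (hcx _).2 (h₂.trans (hle.trans h₁))⟩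
      have hm₂ : ConstBetween β (u y) (max (u x) (c (u y))) :=
        (hcd _ _).2 ⟨le_max_right _ _,
          (max_le (hu hxy).le (hcx _).1).trans (hcx _).2⟩
      exact hC ((htu x).trans ((mapt (hm₁.trans hm₂.symm)).trans (htu y).symm))
  have hsurj : Function.Surjective H := by
    intro y
    have hxC : ConstBetween β (u (G y)) y := ((hut y).trans (mapu (hG y))).symm
    refine ⟨G y, Subtype.ext ?_⟩
    change affineIcc (a (G y)) (b (G y)) (c (u (G y))) (d (u (G y)))
      (affineIcc (c y) (d y) (a (t y)) (b (t y)) y) = y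
    rw [(hcdeq hxC).1, (hcdeq hxC).2, ← (habeq (hG y)).1, ← (habeq (hG y)).2]
    rcases ((hcx y).1.trans (hcx y).2).eq_or_lt with heq | hlt
    · have : c y = y := le_antisymm (hcx y).1 (heq ▸ (hcx y).2)
      simp [affineIcc, ← heq, this]
    · have hC : ConstBetween β (c y) (d y) :=
        ((hcd y _).2 ⟨le_rfl, hlt.le⟩).symm.trans ((hcd y _).2 ⟨hlt.le, le_rfl⟩)
      have h₁ := (hab (t y) _).1 (mapt ((hcd y _).2 ⟨le_rfl, hlt.le⟩))
      have h₂ := (hab (t y) _).1 (mapt ((hcd y _).2 ⟨hlt.le, le_rfl⟩))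
      exact affineIcc_affineIcc (h₁.1.trans_lt ((ht hlt).trans_le h₂.2)) hlt
  refine ⟨(hmono.orderIsoOfSurjective H hsurj).toHomeomorph, hmono, funext fun x => ?_⟩
  exact (congrFun hαu x).trans (hH x _ right_mem_uIcc).symm

/-- The relation `≥ᵣ` is antisymmetric up to path equivalence `≡`. -/
theorem geodesicReduction_antisymm {X : Type*} [TopologicalSpace X] [T2Space X]
    (α β : unitInterval → X) (hα : Continuous α) (hβ : Continuous β)
    (h₁ : GeodesicReduction α β) (h₂ : GeodesicReduction β α) :
    PathEquiv α β := by
  obtain ⟨t, ht, hβt⟩ := h₁.exists_strictMono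
  obtain ⟨u, hu, hαu⟩ := h₂.exists_strictMono
  exact pathEquiv_of_strictMono hα hβ ht hu hβt hαu
end

section
/- Let X be a Hausdorff topological space and α₁, α₂, β₁, β₂ : [0,1] → X be paths with α₁ ≃ᵣ β₁, α₂ ≃ᵣ β₂, and α₁(1) = α₂(0). Then the concatenations satisfy α₁·α₂ ≃ᵣ β₁·β₂. -/
open Set Filter Topology

section Arcs

variable {W : Type*} [TopologicalSpace W]

/-- Any two arcs lying in `A` with the same endpoints have the same image. -/
def UniquelyArcwiseOn (A : Set W) : Prop :=
  ∀ p q : unitInterval → W, Continuous p → Continuous q →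
    Function.Injective p → Function.Injective q → (∀ t, p t ∈ A) → (∀ t, q t ∈ A) →
    p 0 = q 0 → p 1 = q 1 → Set.range p = Set.range q

theorem exists_continuous_injective_range_eq_Icc {s t : unitInterval} (hst : s < t) :
    ∃ φ : unitInterval → unitInterval, Continuous φ ∧ Function.Injective φ ∧
      φ 0 = s ∧ φ 1 = t ∧ Set.range φ = Set.Icc s t := by
  have hst' : (s : ℝ) < t := hst
  have hd : 0 < (t : ℝ) - s := sub_pos.2 hst'
  have hmem (u : unitInterval) : (s : ℝ) + (t - s) * u ∈ unitInterval := by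
    constructor
    · nlinarith [s.2.1, u.2.1]
    · nlinarith [t.2.2, u.2.2, u.2.1]
  let φ : unitInterval → unitInterval := fun u => ⟨(s : ℝ) + (t - s) * u, hmem u⟩
  have hφc : Continuous φ := by fun_prop
  have h0 : φ 0 = s := Subtype.ext (by simp [φ])
  have h1 : φ 1 = t := Subtype.ext (by simp [φ])
  refine ⟨φ, hφc, fun u v huv => ?_, h0, h1, ?_⟩
  · have : (s : ℝ) + (t - s) * u = s + (t - s) * v := congrArg Subtype.val huv
    exact Subtype.ext (mul_left_cancel₀ hd.ne' (add_left_cancel this))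
  · apply Set.Subset.antisymm
    · rintro _ ⟨u, rfl⟩
      constructor
      · change (s : ℝ) ≤ s + (t - s) * u
        nlinarith [u.2.1]
      · change (s : ℝ) + (t - s) * u ≤ t
        nlinarith [u.2.2]
    · have := intermediate_value_Icc (zero_le_one (α := unitInterval)) hφc.continuousOn
      rw [h0, h1] at this
      exact this.trans (Set.image_subset_range _ _)

/-- A path meeting both of two closed sets covering the space meets their intersection. -/
theorem exists_mem_Icc_mem_inter {A B : Set W} (hA : IsClosed A) (hB : IsClosed B)
    (hAB : A ∪ B = Set.univ) {p : unitInterval → W} (hp : Continuous p) {a b : unitInterval}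
    (hA' : ∃ t ∈ Set.Icc a b, p t ∈ A) (hB' : ∃ t ∈ Set.Icc a b, p t ∈ B) :
    ∃ t ∈ Set.Icc a b, p t ∈ A ∩ B :=
  isPreconnected_closed_iff.1 isPreconnected_Icc (p ⁻¹' A) (p ⁻¹' B) (hA.preimage hp)
    (hB.preimage hp) (by rw [← Set.preimage_union, hAB]; exact Set.subset_univ _) hA' hB'

theorem arc_mem_of_endpoints_mem {A B : Set W} (hA : IsClosed A) (hB : IsClosed B)
    (hAB : A ∪ B = Set.univ) (hsub : (A ∩ B).Subsingleton) {p : unitInterval → W}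
    (hp : Continuous p) (hinj : Function.Injective p) (h0 : p 0 ∈ A) (h1 : p 1 ∈ A)
    (t : unitInterval) : p t ∈ A := by
  by_contra ht
  have htB : p t ∈ B := (hAB.symm ▸ Set.mem_univ (p t) : p t ∈ A ∪ B).resolve_left ht
  obtain ⟨s, hs, hsw⟩ := exists_mem_Icc_mem_inter hA hB hAB hp (a := 0) (b := t)
    ⟨0, ⟨le_rfl, t.2.1⟩, h0⟩ ⟨t, ⟨t.2.1, le_rfl⟩, htB⟩
  obtain ⟨s', hs', hsw'⟩ := exists_mem_Icc_mem_inter hA hB hAB hp (a := t) (b := 1)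
    ⟨1, ⟨t.2.2, le_rfl⟩, h1⟩ ⟨t, ⟨le_rfl, t.2.2⟩, htB⟩
  have hss : s = s' := hinj (hsub hsw hsw')
  have hst : s = t := le_antisymm hs.2 (hss ▸ hs'.1)
  exact ht (hst ▸ hsw.1)

theorem UniquelyArcwiseOn.image_Icc_eq {A B : Set W} (hA : IsClosed A) (hB : IsClosed B)
    (hAB : A ∪ B = Set.univ) (hsub : (A ∩ B).Subsingleton) (h : UniquelyArcwiseOn A)
    {p q : unitInterval → W} (hp : Continuous p) (hq : Continuous q)
    (hpi : Function.Injective p) (hqi : Function.Injective q) {a b a' b' : unitInterval}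
    (hab : a < b) (hab' : a' < b') (haA : p a ∈ A) (hbA : p b ∈ A)
    (ha : p a = q a') (hb : p b = q b') :
    p '' Set.Icc a b = q '' Set.Icc a' b' := by
  obtain ⟨φ, hφ, hφi, hφ0, hφ1, hφr⟩ := exists_continuous_injective_range_eq_Icc hab
  obtain ⟨ψ, hψ, hψi, hψ0, hψ1, hψr⟩ := exists_continuous_injective_range_eq_Icc hab'
  rw [← hφr, ← hψr, ← Set.range_comp, ← Set.range_comp]
  have hA_of {r : unitInterval → W} := arc_mem_of_endpoints_mem hA hB hAB hsub (p := r)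
  refine h _ _ (hp.comp hφ) (hq.comp hψ) (hpi.comp hφi) (hqi.comp hψi)
    (hA_of (hp.comp hφ) (hpi.comp hφi) ?_ ?_) (hA_of (hq.comp hψ) (hqi.comp hψi) ?_ ?_) ?_ ?_
  all_goals simp only [Function.comp_apply, hφ0, hφ1, hψ0, hψ1, ← ha, ← hb]
  all_goals assumption

theorem UniquelyArcwiseOn.range_eq_of_mem {A B : Set W} (hA : IsClosed A) (hB : IsClosed B)
    (hAB : A ∪ B = Set.univ) (hsub : (A ∩ B).Subsingleton) (h : UniquelyArcwiseOn A)
    {p q : unitInterval → W} (hp : Continuous p) (hq : Continuous q)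
    (hpi : Function.Injective p) (hqi : Function.Injective q) (h0 : p 0 = q 0) (h1 : p 1 = q 1)
    (h0A : p 0 ∈ A) (h1A : p 1 ∈ A) :
    Set.range p = Set.range q :=
  h p q hp hq hpi hqi (arc_mem_of_endpoints_mem hA hB hAB hsub hp hpi h0A h1A)
    (arc_mem_of_endpoints_mem hA hB hAB hsub hq hqi (h0 ▸ h0A) (h1 ▸ h1A)) h0 h1

theorem UniquelyArcwiseOn.range_eq_of_mem_of_mem {A B : Set W} (hA : IsClosed A)
    (hB : IsClosed B) (hAB : A ∪ B = Set.univ) (hsub : (A ∩ B).Subsingleton)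
    (hUA : UniquelyArcwiseOn A) (hUB : UniquelyArcwiseOn B)
    {p q : unitInterval → W} (hp : Continuous p) (hq : Continuous q)
    (hpi : Function.Injective p) (hqi : Function.Injective q) (h0 : p 0 = q 0) (h1 : p 1 = q 1)
    (h0A : p 0 ∈ A) (h1B : p 1 ∈ B) :
    Set.range p = Set.range q := by
  have hBA : B ∪ A = Set.univ := by rwa [Set.union_comm]
  have hsub' : (B ∩ A).Subsingleton := by rwa [Set.inter_comm]
  by_cases h0B : p 0 ∈ B
  · exact hUB.range_eq_of_mem hB hA hBA hsub' hp hq hpi hqi h0 h1 h0B h1B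
  by_cases h1A : p 1 ∈ A
  · exact hUA.range_eq_of_mem hA hB hAB hsub hp hq hpi hqi h0 h1 h0A h1A
  have key {r : unitInterval → W} (hr : Continuous r) (hr0 : p 0 = r 0) (hr1 : p 1 = r 1) :
      ∃ t, 0 < t ∧ t < 1 ∧ r t ∈ A ∩ B := by
    obtain ⟨t, -, ht⟩ := exists_mem_Icc_mem_inter hA hB hAB hr (a := 0) (b := 1)
      ⟨0, by simp, hr0 ▸ h0A⟩ ⟨1, by simp, hr1 ▸ h1B⟩
    refine ⟨t, unitInterval.pos_iff_ne_zero.2 ?_, unitInterval.lt_one_iff_ne_one.2 ?_, ht⟩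
    · rintro rfl
      exact h0B (hr0 ▸ ht.2)
    · rintro rfl
      exact h1A (hr1 ▸ ht.1)
  obtain ⟨s, hs0, hs1, hs⟩ := key hp rfl rfl
  obtain ⟨t, ht0, ht1, ht⟩ := key hq h0 h1
  have hst := hsub hs ht
  have hsplit (r : unitInterval → W) (u : unitInterval) :
      Set.range r = r '' Set.Icc 0 u ∪ r '' Set.Icc u 1 := by
    have hu : Set.Icc 0 u ∪ Set.Icc u 1 = Set.univ :=
      Set.eq_univ_of_forall fun x => (le_total x u).imp (fun h => ⟨x.2.1, h⟩) fun h => ⟨h, x.2.2⟩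
    rw [← Set.image_union, hu, Set.image_univ]
  rw [hsplit p s, hsplit q t,
    hUA.image_Icc_eq hA hB hAB hsub hp hq hpi hqi hs0 ht0 h0A hs.1 h0 hst,
    hUB.image_Icc_eq hB hA hBA hsub' hp hq hpi hqi hs1 ht1 hs.2 h1B hst h1]

/-- Unique arcwise connectedness of a union of two closed sets meeting in at most one point. -/
theorem UniquelyArcwiseOn.univ_of_union {A B : Set W} (hA : IsClosed A) (hB : IsClosed B)
    (hAB : A ∪ B = Set.univ) (hsub : (A ∩ B).Subsingleton)
    (hUA : UniquelyArcwiseOn A) (hUB : UniquelyArcwiseOn B) :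
    UniquelyArcwiseOn (Set.univ : Set W) := by
  intro p q hp hq hpi hqi _ _ h0 h1
  have hBA : B ∪ A = Set.univ := by rwa [Set.union_comm]
  have hsub' : (B ∩ A).Subsingleton := by rwa [Set.inter_comm]
  have hcov (x : W) : x ∈ A ∪ B := hAB.symm ▸ Set.mem_univ x
  rcases hcov (p 0) with h0A | h0B <;> rcases hcov (p 1) with h1A | h1B
  · exact hUA.range_eq_of_mem hA hB hAB hsub hp hq hpi hqi h0 h1 h0A h1A
  · exact hUA.range_eq_of_mem_of_mem hA hB hAB hsub hUB hp hq hpi hqi h0 h1 h0A h1B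
  · exact hUB.range_eq_of_mem_of_mem hB hA hBA hsub' hUA hp hq hpi hqi h0 h1 h0B h1A
  · exact hUB.range_eq_of_mem hB hA hBA hsub' hp hq hpi hqi h0 h1 h0B h1B

/-- Unique arcwise connectedness of an ℝ-tree passes to its image under an embedding with
a continuous left inverse. -/
theorem IsRTree.uniquelyArcwiseOn {T : Type} [MetricSpace T] (hT : IsRTree T) {A : Set W}
    {i : T → W} {r : W → T} (hr : Continuous r) (hir : ∀ x ∈ A, i (r x) = x) :
    UniquelyArcwiseOn A := by
  intro p q hp hq hpi hqi hpA hqA h0 h1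
  have hcomp {s : unitInterval → W} (hs : ∀ t, s t ∈ A) : i ∘ r ∘ s = s :=
    funext fun t => hir _ (hs t)
  have hinj {s : unitInterval → W} (hs : ∀ t, s t ∈ A) (hsi : Function.Injective s) :
      Function.Injective (r ∘ s) :=
    Function.Injective.of_comp (f := i) ((hcomp hs).symm ▸ hsi)
  have := hT.uniquelyArcwise (r ∘ p) (r ∘ q) (hr.comp hp) (hr.comp hq) (hinj hpA hpi)
    (hinj hqA hqi) (congrArg r h0) (congrArg r h1)
  rw [← hcomp hpA, ← hcomp hqA, Set.range_comp i, this, ← Set.range_comp i]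

end Arcs

/-- The points `x` and `y` are joined by a geodesic. -/
def GeodesicJoined {T : Type*} [PseudoMetricSpace T] (x y : T) : Prop :=
  ∃ γ : ℝ → T, γ 0 = x ∧ γ (dist x y) = y ∧
    ∀ s ∈ Set.Icc (0:ℝ) (dist x y), ∀ t ∈ Set.Icc (0:ℝ) (dist x y),
      dist (γ s) (γ t) = |s - t|

theorem GeodesicJoined.symm {T : Type*} [PseudoMetricSpace T] {x y : T}
    (h : GeodesicJoined x y) : GeodesicJoined y x := by
  obtain ⟨γ, h0, h1, hγ⟩ := h
  refine ⟨fun s => γ (dist x y - s), by simpa using h1, by simpa [dist_comm y x] using h0, ?_⟩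
  rw [dist_comm y x]
  intro s hs t ht
  rw [hγ _ ⟨by linarith [hs.2], by linarith [hs.1]⟩ _ ⟨by linarith [ht.2], by linarith [ht.1]⟩,
    abs_sub_comm]
  congr 1
  ring

theorem GeodesicJoined.joinedIn_ball {T : Type*} [PseudoMetricSpace T] {x y : T} {ε : ℝ}
    (h : GeodesicJoined x y) (hy : y ∈ Metric.ball x ε) : JoinedIn (Metric.ball x ε) x y := by
  obtain ⟨γ, h0, h1, hγ⟩ := h
  have hmem {s : ℝ} (hs : s ∈ unitInterval) : dist x y * s ∈ Set.Icc 0 (dist x y) :=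
    ⟨mul_nonneg dist_nonneg hs.1, mul_le_of_le_one_right dist_nonneg hs.2⟩
  have hcont : ContinuousOn γ (Set.Icc 0 (dist x y)) := by
    refine LipschitzOnWith.continuousOn (K := 1) (LipschitzOnWith.of_dist_le_mul ?_)
    intro s hs t ht
    simp [hγ s hs t ht, Real.dist_eq]
  refine JoinedIn.ofLine (f := fun s => γ (dist x y * s))
    (hcont.comp (by fun_prop) fun s hs => hmem hs) (by simpa using h0) (by simpa using h1) ?_
  rintro _ ⟨s, hs, rfl⟩
  rw [Metric.mem_ball'] at hy ⊢
  have hdist := hγ 0 ⟨le_rfl, dist_nonneg⟩ _ (hmem hs)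
  rw [h0, zero_sub, abs_neg, abs_of_nonneg (hmem hs).1] at hdist
  exact (hdist.trans_le (hmem hs).2).trans_lt hy

theorem locallyPathConnectedSpace_of_geodesicJoined {T : Type*} [PseudoMetricSpace T]
    (h : ∀ x y : T, GeodesicJoined x y) : LocallyPathConnectedSpace T :=
  .of_bases (fun _ => Metric.nhds_basis_ball) fun x _ hε =>
    ⟨x, Metric.mem_ball_self hε, fun {y} hy => (h x y).joinedIn_ball hy⟩

section Wedge

variable {S T : Type}

/-- The wedge of two pointed metric spaces, realized as the union of the two axes in the
`L¹` product. -/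
def Wedge (p : S) (q : T) : Type :=
  {z : WithLp 1 (S × T) // z.fst = p ∨ z.snd = q}

namespace Wedge

variable {p : S} {q : T}

/-- The first coordinate. -/
def fst (z : Wedge p q) : S := z.1.fst

/-- The second coordinate. -/
def snd (z : Wedge p q) : T := z.1.snd

/-- The point of the wedge with given coordinates. -/
def mk (x : S) (y : T) (h : x = p ∨ y = q) : Wedge p q := ⟨WithLp.toLp 1 (x, y), h⟩

@[simp] theorem fst_mk (x : S) (y : T) (h : x = p ∨ y = q) : (mk x y h).fst = x := rfl

@[simp] theorem snd_mk (x : S) (y : T) (h : x = p ∨ y = q) : (mk x y h).snd = y := rfl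

theorem fst_eq_or_snd_eq (z : Wedge p q) : z.fst = p ∨ z.snd = q := z.2

variable (p q) in
/-- The inclusion of the first space. -/
def inl (x : S) : Wedge p q := mk x q (Or.inr rfl)

variable (p q) in
/-- The inclusion of the second space. -/
def inr (y : T) : Wedge p q := mk p y (Or.inl rfl)

theorem inl_eq_inr : inl p q p = inr p q q := rfl

theorem union_eq_univ : {z : Wedge p q | z.snd = q} ∪ {z : Wedge p q | z.fst = p} = Set.univ :=
  Set.eq_univ_of_forall fun z => z.fst_eq_or_snd_eq.symm

/-- The map out of the wedge given by maps out of the two spaces. -/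
noncomputable def desc {X : Type*} (f : S → X) (g : T → X) (z : Wedge p q) : X :=
  open Classical in if z.snd = q then f z.fst else g z.snd

variable {X : Type*} {f : S → X} {g : T → X}

theorem desc_inl (x : S) : desc f g (inl p q x) = f x := if_pos rfl

theorem desc_eq_of_fst_eq (h : f p = g q) {z : Wedge p q} (hz : z.fst = p) :
    desc f g z = g z.snd := by
  unfold desc
  split_ifs with hq
  · rw [hz, hq, h]
  · rfl

theorem desc_inr (h : f p = g q) (y : T) : desc f g (inr p q y) = g y :=
  desc_eq_of_fst_eq h rfl

variable [MetricSpace S] [MetricSpace T]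

noncomputable instance : MetricSpace (Wedge p q) :=
  inferInstanceAs (MetricSpace {z : WithLp 1 (S × T) // z.fst = p ∨ z.snd = q})

theorem dist_eq (z w : Wedge p q) : dist z w = dist z.fst w.fst + dist z.snd w.snd := by
  change dist z.1 w.1 = _
  rw [WithLp.prod_dist_eq_add (by simp)]
  simp [fst, snd]

theorem ext {z w : Wedge p q} (h1 : z.fst = w.fst) (h2 : z.snd = w.snd) : z = w := by
  rw [← dist_eq_zero, dist_eq, h1, h2, dist_self, dist_self, add_zero]

theorem continuous_fst : Continuous (fst : Wedge p q → S) :=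
  (LipschitzWith.of_dist_le_mul (K := 1) fun z w => by
    rw [dist_eq, NNReal.coe_one, one_mul]
    exact le_add_of_nonneg_right dist_nonneg).continuous

theorem continuous_snd : Continuous (snd : Wedge p q → T) :=
  (LipschitzWith.of_dist_le_mul (K := 1) fun z w => by
    rw [dist_eq, NNReal.coe_one, one_mul]
    exact le_add_of_nonneg_left dist_nonneg).continuous

theorem continuous_inl : Continuous (inl p q) :=
  (Isometry.of_dist_eq fun x y => by simp [dist_eq, inl]).continuous

theorem continuous_inr : Continuous (inr p q) :=
  (Isometry.of_dist_eq fun x y => by simp [dist_eq, inr]).continuous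

theorem isClosed_snd_eq : IsClosed {z : Wedge p q | z.snd = q} :=
  isClosed_eq continuous_snd continuous_const

theorem isClosed_fst_eq : IsClosed {z : Wedge p q | z.fst = p} :=
  isClosed_eq continuous_fst continuous_const

theorem continuous_desc [TopologicalSpace X] (hf : Continuous f) (hg : Continuous g)
    (h : f p = g q) : Continuous (desc f g : Wedge p q → X) := by
  rw [← continuousOn_univ, ← union_eq_univ]
  refine ContinuousOn.union_of_isClosed ?_ ?_ isClosed_snd_eq isClosed_fst_eq
  · exact (hf.comp continuous_fst).continuousOn.congr fun z hz => if_pos hz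
  · exact (hg.comp continuous_snd).continuousOn.congr fun z hz => desc_eq_of_fst_eq h hz

/-- A geodesic first following the first coordinate, then the second one. -/
theorem geodesicJoined_of {u v : Wedge p q} (h1 : GeodesicJoined u.fst v.fst)
    (h2 : GeodesicJoined u.snd v.snd)
    (h : u.snd = q ∧ v.snd = q ∨ u.fst = p ∧ v.fst = p ∨ u.snd = q ∧ v.fst = p) :
    GeodesicJoined u v := by
  obtain ⟨γ, hγ0, hγ1, hγ⟩ := h1
  obtain ⟨δ, hδ0, hδ1, hδ⟩ := h2
  unfold GeodesicJoined
  rw [dist_eq]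
  set a := dist u.fst v.fst with ha
  set b := dist u.snd v.snd with hb
  have ha0 : 0 ≤ a := dist_nonneg
  have hb0 : 0 ≤ b := dist_nonneg
  have hmem (s : ℝ) : γ (max 0 (min s a)) = p ∨ δ (max 0 (min (s - a) b)) = q := by
    rcases h with ⟨hu, hv⟩ | ⟨hu, hv⟩ | ⟨hu, hv⟩
    · right
      have : b = 0 := by rw [hb, hu, hv, dist_self]
      rw [this, max_eq_left (min_le_right _ _), hδ0, hu]
    · left
      have : a = 0 := by rw [ha, hu, hv, dist_self]
      rw [this, max_eq_left (min_le_right _ _), hγ0, hu]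
    · rcases le_total s a with hs | hs
      · right
        rw [max_eq_left ((min_le_left _ _).trans (sub_nonpos.2 hs)), hδ0, hu]
      · left
        rw [min_eq_right hs, max_eq_right ha0, hγ1, hv]
  refine ⟨fun s => mk (γ (max 0 (min s a))) (δ (max 0 (min (s - a) b))) (hmem s),
    ext ?_ ?_, ext ?_ ?_, fun s hs t ht => ?_⟩
  · simp [ha0, hγ0]
  · simp [ha0, hδ0]
  · simp [ha0, hb0, hγ1]
  · simp [hb0, hδ1]
  · have hI (x c : ℝ) (hc : 0 ≤ c) : max 0 (min x c) ∈ Set.Icc 0 c :=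
      ⟨le_max_left _ _, max_le hc (min_le_right _ _)⟩
    rw [dist_eq, fst_mk, fst_mk, snd_mk, snd_mk, hγ _ (hI s a ha0) _ (hI t a ha0),
      hδ _ (hI (s - a) b hb0) _ (hI (t - a) b hb0)]
    obtain ⟨hs0, hs1⟩ := hs
    obtain ⟨ht0, ht1⟩ := ht
    grind

theorem isRTree (hS : IsRTree S) (hT : IsRTree T) : IsRTree (Wedge p q) := by
  have hgeo (u v : Wedge p q) : GeodesicJoined u v := by
    have h1 : GeodesicJoined u.fst v.fst := hS.geodesic _ _
    have h2 : GeodesicJoined u.snd v.snd := hT.geodesic _ _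
    rcases u.fst_eq_or_snd_eq with hu | hu <;> rcases v.fst_eq_or_snd_eq with hv | hv
    · exact geodesicJoined_of h1 h2 (.inr (.inl ⟨hu, hv⟩))
    · exact (geodesicJoined_of h1.symm h2.symm (.inr (.inr ⟨hv, hu⟩))).symm
    · exact geodesicJoined_of h1 h2 (.inr (.inr ⟨hu, hv⟩))
    · exact geodesicJoined_of h1 h2 (.inl ⟨hu, hv⟩)
  have hUA : UniquelyArcwiseOn {z : Wedge p q | z.snd = q} :=
    hS.uniquelyArcwiseOn (i := inl p q) continuous_fst fun z hz => ext rfl (Eq.symm hz)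
  have hUB : UniquelyArcwiseOn {z : Wedge p q | z.fst = p} :=
    hT.uniquelyArcwiseOn (i := inr p q) continuous_snd fun z hz => ext (Eq.symm hz) rfl
  have hsub : ({z : Wedge p q | z.snd = q} ∩ {z : Wedge p q | z.fst = p}).Subsingleton :=
    fun z hz w hw => ext (hz.2.trans hw.2.symm) (hz.1.trans hw.1.symm)
  exact
    { nonempty := ⟨inl p q p⟩
      geodesic := hgeo
      uniquelyArcwise := fun r s hr hs hri hsi =>
        hUA.univ_of_union isClosed_snd_eq isClosed_fst_eq union_eq_univ hsub hUB r s hr hs hri hsi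
          (fun _ => Set.mem_univ _) (fun _ => Set.mem_univ _)
      locallyArcwise := locallyPathConnectedSpace_of_geodesicJoined hgeo }

end Wedge

end Wedge

section Concatenation

variable {X Y : Type*}

theorem comp_concatReverse (f : X → Y) (α β : unitInterval → X) :
    f ∘ ConcatReverse α β = ConcatReverse (f ∘ α) (f ∘ β) :=
  funext fun _ => apply_ite f _ _ _

theorem comp_pathConcat (f : X → Y) (α β : unitInterval → X) :
    f ∘ PathConcat α β = PathConcat (f ∘ α) (f ∘ β) :=
  funext fun _ => apply_ite f _ _ _

theorem pathConcat_zero (α β : unitInterval → X) : PathConcat α β 0 = α 0 := by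
  simp [PathConcat]

theorem pathConcat_one (α β : unitInterval → X) : PathConcat α β 1 = β 1 := by
  norm_num [PathConcat]

theorem concatReverse_zero (α β : unitInterval → X) : ConcatReverse α β 0 = α 0 := by
  simp [ConcatReverse]

theorem concatReverse_one (α β : unitInterval → X) : ConcatReverse α β 1 = β 0 := by
  norm_num [ConcatReverse]

/-- The parametrization of the first half of a concatenation. -/
noncomputable def firstHalf (t : unitInterval) : unitInterval :=
  ⟨t / 2, by linarith [t.2.1], by linarith [t.2.2]⟩

/-- The reversed parametrization of the second half of a concatenation. -/
noncomputable def secondHalfReverse (t : unitInterval) : unitInterval :=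
  ⟨1 - t / 2, by linarith [t.2.2], by linarith [t.2.1]⟩

theorem continuous_firstHalf : Continuous firstHalf := by
  unfold firstHalf
  fun_prop

theorem continuous_secondHalfReverse : Continuous secondHalfReverse := by
  unfold secondHalfReverse
  fun_prop

theorem concatReverse_firstHalf (α β : unitInterval → X) (t : unitInterval) :
    ConcatReverse α β (firstHalf t) = α t := by
  have h : (t : ℝ) / 2 ≤ 1 / 2 := by linarith [t.2.2]
  simp only [ConcatReverse, firstHalf, if_pos h, mul_div_cancel₀ (t : ℝ) two_ne_zero,
    Set.projIcc_val]

theorem concatReverse_secondHalfReverse {α β : unitInterval → X} (h : α 1 = β 1)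
    (t : unitInterval) : ConcatReverse α β (secondHalfReverse t) = β t := by
  rcases eq_or_ne t 1 with rfl | ht
  · rw [← h]
    norm_num [ConcatReverse, secondHalfReverse]
  · have ht' : (t : ℝ) < 1 := unitInterval.lt_one_iff_ne_one.2 ht
    have h' : ¬ 1 - (t : ℝ) / 2 ≤ 1 / 2 := by linarith
    simp only [ConcatReverse, secondHalfReverse, if_neg h',
      show 2 - 2 * (1 - (t : ℝ) / 2) = t by ring, Set.projIcc_val]

variable [TopologicalSpace X]

theorem continuous_concatReverse {α β : unitInterval → X} (hα : Continuous α)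
    (hβ : Continuous β) (h : α 1 = β 1) : Continuous (ConcatReverse α β) := by
  refine Continuous.if_le (hα.comp (continuous_projIcc.comp (by fun_prop)))
    (hβ.comp (continuous_projIcc.comp (by fun_prop))) continuous_subtype_val continuous_const ?_
  intro t ht
  simp only [ht]
  norm_num [h]

theorem continuous_pathConcat {α β : unitInterval → X} (hα : Continuous α)
    (hβ : Continuous β) (h : α 1 = β 0) : Continuous (PathConcat α β) := by
  refine Continuous.if_le (hα.comp (continuous_projIcc.comp (by fun_prop)))
    (hβ.comp (continuous_projIcc.comp (by fun_prop))) continuous_subtype_val continuous_const ?_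
  intro t ht
  simp only [ht]
  norm_num [h]

/-- Two paths are ℝ-tree homotopic iff they lift along a map from an ℝ-tree to paths with
common endpoints. -/
theorem rTreeHomotopic_iff_exists_lifts {α β : unitInterval → X} :
    RTreeHomotopic α β ↔ ∃ (T : Type) (_ : MetricSpace T), IsRTree T ∧
      ∃ (f : T → X) (a b : unitInterval → T), Continuous f ∧ Continuous a ∧ Continuous b ∧
        a 0 = b 0 ∧ a 1 = b 1 ∧ f ∘ a = α ∧ f ∘ b = β := by
  constructor
  · rintro ⟨-, h1, T, _, hT, f, l, hf, hl, hl01, hfl⟩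
    refine ⟨T, _, hT, f, l ∘ firstHalf, l ∘ secondHalfReverse, hf, hl.comp continuous_firstHalf,
      hl.comp continuous_secondHalfReverse, ?_, ?_, ?_, ?_⟩
    · have e0 : firstHalf 0 = 0 := Subtype.ext (by simp [firstHalf])
      have e1 : secondHalfReverse 0 = 1 := Subtype.ext (by simp [secondHalfReverse])
      simp only [Function.comp_apply, e0, e1, hl01]
    · have e : firstHalf 1 = secondHalfReverse 1 :=
        Subtype.ext (by norm_num [firstHalf, secondHalfReverse])
      simp only [Function.comp_apply, e]
    · rw [← Function.comp_assoc, hfl]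
      exact funext (concatReverse_firstHalf α β)
    · rw [← Function.comp_assoc, hfl]
      exact funext (concatReverse_secondHalfReverse h1)
  · rintro ⟨T, _, hT, f, a, b, hf, ha, hb, h0, h1, rfl, rfl⟩
    refine ⟨congrArg f h0, congrArg f h1, T, _, hT, f, ConcatReverse a b, hf,
      continuous_concatReverse ha hb h1, ?_, comp_concatReverse f a b⟩
    rw [concatReverse_zero, concatReverse_one, h0]

end Concatenation

/-- `≃ᵣ` is preserved by concatenation of paths. -/
theorem rTreeHomotopic_concat {X : Type*} [TopologicalSpace X] [T2Space X]
    (α₁ α₂ β₁ β₂ : unitInterval → X)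
    (hα₁ : Continuous α₁) (hα₂ : Continuous α₂) (hβ₁ : Continuous β₁) (hβ₂ : Continuous β₂)
    (h₁ : RTreeHomotopic α₁ β₁) (h₂ : RTreeHomotopic α₂ β₂)
    (hcomp : α₁ 1 = α₂ 0) :
    RTreeHomotopic (PathConcat α₁ α₂) (PathConcat β₁ β₂) := by
  obtain ⟨S, _, hS, f, a₁, b₁, hf, ha₁, hb₁, h₁0, h₁1, rfl, rfl⟩ :=
    rTreeHomotopic_iff_exists_lifts.1 h₁
  obtain ⟨T, _, hT, g, a₂, b₂, hg, ha₂, hb₂, h₂0, h₂1, rfl, rfl⟩ :=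
    rTreeHomotopic_iff_exists_lifts.1 h₂
  have hfg : f (a₁ 1) = g (a₂ 0) := hcomp
  let i := Wedge.inl (a₁ 1) (a₂ 0)
  let j := Wedge.inr (a₁ 1) (a₂ 0)
  have hi : Continuous i := Wedge.continuous_inl
  have hj : Continuous j := Wedge.continuous_inr
  have hij : i (a₁ 1) = j (a₂ 0) := Wedge.inl_eq_inr
  have hF₁ (c : unitInterval → S) : Wedge.desc f g ∘ i ∘ c = f ∘ c :=
    funext fun t => Wedge.desc_inl (c t)
  have hF₂ (c : unitInterval → T) : Wedge.desc f g ∘ j ∘ c = g ∘ c :=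
    funext fun t => Wedge.desc_inr hfg (c t)
  refine rTreeHomotopic_iff_exists_lifts.2 ⟨Wedge (a₁ 1) (a₂ 0), inferInstance,
    Wedge.isRTree hS hT, Wedge.desc f g, PathConcat (i ∘ a₁) (j ∘ a₂),
    PathConcat (i ∘ b₁) (j ∘ b₂), Wedge.continuous_desc hf hg hfg,
    continuous_pathConcat (hi.comp ha₁) (hj.comp ha₂) hij,
    continuous_pathConcat (hi.comp hb₁) (hj.comp hb₂) ?_, ?_, ?_, ?_, ?_⟩
  · simpa only [Function.comp_apply, ← h₁1, ← h₂0] using hij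
  · simp only [pathConcat_zero, Function.comp_apply, h₁0]
  · simp only [pathConcat_one, Function.comp_apply, h₂1]
  · rw [comp_pathConcat, hF₁, hF₂]
  · rw [comp_pathConcat, hF₁, hF₂]
end
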